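/- arXiv:math/0603670 — 3 statements merged into one kernel-verified Lean document; each statement's English description precedes it below -/
import Mathlib

section
/- An irreducible, infinite Coxeter group (W,S) of finite rank is affine if and only if W contains an abelian subgroup of finite index. -/
namespace CoxeterPaper

/-- The entry `-cos (π / m i j)` of the matrix of the standard bilinear form,
interpreted as `-1` when `m i j = ∞` (encoded as `0`). -/
noncomputable def formEntry {B : Type*} (M : CoxeterMatrix B) (i j : B) : ℝ :=
  if M i j = 0 then -1 else - Real.cos (Real.pi / (M i j : ℝ))

/-- The standard bilinear form associated to a Coxeter matrix, on `V = B → ℝ`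
(with basis `{α_s : s ∈ S}` identified with the standard basis). -/
noncomputable def bilin {B : Type*} [Fintype B] (M : CoxeterMatrix B) (v w : B → ℝ) : ℝ :=
  ∑ i, ∑ j, v i * w j * formEntry M i j

/-- The standard bilinear form is positive definite. -/
def IsPosDef {B : Type*} [Fintype B] (M : CoxeterMatrix B) : Prop :=
  ∀ v : B → ℝ, v ≠ 0 → 0 < bilin M v v

/-- The standard bilinear form is positive semidefinite. -/
def IsPosSemidef {B : Type*} [Fintype B] (M : CoxeterMatrix B) : Prop :=
  ∀ v : B → ℝ, 0 ≤ bilin M v v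

/-- The Coxeter graph: vertices are the elements of `B`, and `i ≠ j` are adjacent
iff `m i j ≥ 3` (including `m i j = ∞`, encoded as `0`), i.e. iff `m i j ≠ 2`. -/
def coxeterGraph {B : Type*} (M : CoxeterMatrix B) : SimpleGraph B :=
  SimpleGraph.fromRel fun i j => M i j ≠ 2

/-- A Coxeter matrix (system) is irreducible if its Coxeter graph is connected. -/
def IsIrreducible {B : Type*} (M : CoxeterMatrix B) : Prop := (coxeterGraph M).Connected

section Representation

variable {B W : Type*}

theorem formEntry_comm (M : CoxeterMatrix B) (i j : B) : formEntry M i j = formEntry M j i := by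
  simp only [formEntry, M.symmetric i j]

theorem formEntry_self (M : CoxeterMatrix B) (i : B) : formEntry M i i = 1 := by
  simp [formEntry]

theorem formEntry_nonpos (M : CoxeterMatrix B) {i j : B} (h : i ≠ j) : formEntry M i j ≤ 0 := by
  unfold formEntry
  split_ifs with h0
  · norm_num
  · have h1 := M.off_diagonal i j h
    have h2 : (2 : ℝ) ≤ M i j := by
      have : 2 ≤ M i j := by omega
      exact_mod_cast this
    have h3 : Real.pi / (M i j : ℝ) ≤ Real.pi / 2 :=
      div_le_div_of_nonneg_left Real.pi_pos.le (by norm_num) h2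
    have := Real.cos_nonneg_of_neg_pi_div_two_le_of_le
      (by have := Real.pi_pos; have : 0 ≤ Real.pi / (M i j : ℝ) := by positivity
          linarith) h3
    linarith

theorem abs_formEntry_le_one (M : CoxeterMatrix B) (i j : B) : |formEntry M i j| ≤ 1 := by
  unfold formEntry
  split_ifs with h0
  · norm_num
  · rw [abs_neg]; exact Real.abs_cos_le_one _

variable [Fintype B]

/-- The standard bilinear form of a Coxeter matrix as a bilinear map. -/
noncomputable def form (M : CoxeterMatrix B) : (B → ℝ) →ₗ[ℝ] (B → ℝ) →ₗ[ℝ] ℝ :=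
  LinearMap.mk₂ ℝ (bilin M)
    (fun u v w => by simp [bilin, add_mul, Finset.sum_add_distrib])
    (fun c u v => by simp [bilin, Finset.mul_sum, mul_assoc])
    (fun u v w => by simp [bilin, add_mul, mul_add, Finset.sum_add_distrib])
    (fun c u v => by simp [bilin, Finset.mul_sum, mul_assoc, mul_left_comm])

theorem form_apply (M : CoxeterMatrix B) (v w : B → ℝ) : form M v w = bilin M v w := rfl

theorem form_comm (M : CoxeterMatrix B) (v w : B → ℝ) : form M v w = form M w v := by
  simp only [form_apply, bilin]
  rw [Finset.sum_comm]
  refine Finset.sum_congr rfl fun i _ => Finset.sum_congr rfl fun j _ => ?_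
  rw [formEntry_comm M i j]; ring

/-- The orthogonal reflection in a vector `a` (of norm one). -/
noncomputable def reflection (M : CoxeterMatrix B) (a : B → ℝ) : Module.End ℝ (B → ℝ) :=
  LinearMap.id - (2 : ℝ) • (form M a).smulRight a

theorem reflection_apply (M : CoxeterMatrix B) (a v : B → ℝ) :
    reflection M a v = v - (2 * form M a v) • a := by
  simp [reflection, smul_smul]

theorem form_reflection (M : CoxeterMatrix B) {a : B → ℝ} (ha : form M a a = 1) (v w : B → ℝ) :
    form M (reflection M a v) (reflection M a w) = form M v w := by
  simp only [reflection_apply, map_sub, map_smul, LinearMap.sub_apply, LinearMap.smul_apply,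
    smul_eq_mul, ha, form_comm M v a]
  ring

theorem reflection_mul_self (M : CoxeterMatrix B) {a : B → ℝ} (ha : form M a a = 1) :
    reflection M a * reflection M a = 1 := by
  ext1 v
  rw [Module.End.mul_apply, Module.End.one_apply, reflection_apply, reflection_apply]
  simp only [map_sub, map_smul, smul_eq_mul, ha]
  module

/-- Iterating a product of two reflections on the first root, in terms of a sequence `u`
satisfying the Chebyshev recursion. -/
theorem reflection_mul_pow_apply (M : CoxeterMatrix B) {a b : B → ℝ} (ha : form M a a = 1)
    (hb : form M b b = 1) {c : ℝ} (hab : form M a b = -c) {u : ℕ → ℝ} (h0 : u 0 = 0) (h1 : u 1 = 1)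
    (hu : ∀ k, u (k + 2) = 2 * c * u (k + 1) - u k) (k : ℕ) :
    ((reflection M a * reflection M b) ^ k) a = u (2 * k + 1) • a + u (2 * k) • b := by
  induction k with
  | zero => simp [h0, h1]
  | succ k ih =>
    rw [pow_succ', Module.End.mul_apply, ih, Module.End.mul_apply]
    simp only [reflection_apply, map_add, map_sub, map_smul, ha, hb, hab,
      form_comm M b a]
    rw [show 2 * (k + 1) + 1 = (2 * k + 1) + 2 by ring, show 2 * (k + 1) = 2 * k + 2 by ring,
      hu (2 * k + 1), hu (2 * k)]
    module

theorem sin_mul_div_sin_recursion (θ : ℝ) (k : ℕ) :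
    Real.sin ((k + 2 : ℕ) * θ) / Real.sin θ =
      2 * Real.cos θ * (Real.sin ((k + 1 : ℕ) * θ) / Real.sin θ) -
        Real.sin (k * θ) / Real.sin θ := by
  have e1 : ((k + 2 : ℕ) : ℝ) * θ = ((k + 1 : ℕ) : ℝ) * θ + θ := by push_cast; ring
  have e2 : ((k : ℕ) : ℝ) * θ = ((k + 1 : ℕ) : ℝ) * θ - θ := by push_cast; ring
  rw [← mul_div_assoc, ← sub_div, e1, e2, Real.sin_add, Real.sin_sub]
  ring

/-- If two unit vectors make an angle `π - π / m`, the product of their reflections has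
order dividing `m`. -/
theorem reflection_mul_pow_eq_one (M : CoxeterMatrix B) {a b : B → ℝ} (ha : form M a a = 1)
    (hb : form M b b = 1) {m : ℕ} (hm : 2 ≤ m) (hab : form M a b = - Real.cos (Real.pi / m)) :
    (reflection M a * reflection M b) ^ m = 1 := by
  set θ := Real.pi / m with hθ
  have hm0 : (m : ℝ) ≠ 0 := by positivity
  have hsin : 0 < Real.sin θ := by
    apply Real.sin_pos_of_pos_of_lt_pi (by positivity)
    rw [hθ, div_lt_iff₀ (by positivity)]
    have : (2 : ℝ) ≤ m := by exact_mod_cast hm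
    nlinarith [Real.pi_pos]
  have hmθ : (m : ℝ) * θ = Real.pi := by rw [hθ]; field_simp
  have key : ∀ {a b : B → ℝ}, form M a a = 1 → form M b b = 1 → form M a b = - Real.cos θ →
      ((reflection M a * reflection M b) ^ m) a = a := by
    intro a b ha hb hab
    rw [reflection_mul_pow_apply M ha hb hab (u := fun k => Real.sin (k * θ) / Real.sin θ)
      (by simp) (by simp [hsin.ne'])]
    · have e1 : ((2 * m + 1 : ℕ) : ℝ) * θ = θ + 2 * Real.pi := by
        push_cast; rw [← hmθ]; ring
      have e2 : ((2 * m : ℕ) : ℝ) * θ = 2 * Real.pi := by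
        push_cast; rw [← hmθ]; ring
      simp only [e1, e2, Real.sin_add_two_pi, Real.sin_two_pi]
      simp [hsin.ne']
    · exact sin_mul_div_sin_recursion θ
  set r := reflection M a * reflection M b
  set r' := reflection M b * reflection M a
  have hrr : r * r' = 1 := by
    simp only [r, r']
    rw [mul_assoc, ← mul_assoc (reflection M b), reflection_mul_self M hb, one_mul,
      reflection_mul_self M ha]
  have hrr' : r' * r = 1 := by
    simp only [r, r']
    rw [mul_assoc, ← mul_assoc (reflection M a), reflection_mul_self M ha, one_mul,
      reflection_mul_self M hb]
  have hpow : r ^ m * r' ^ m = 1 := by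
    rw [← (show Commute r r' from hrr.trans hrr'.symm).mul_pow, hrr, one_pow]
  have h1 : (r ^ m) a = a := key ha hb hab
  have h2 : (r ^ m) b = b := by
    have h3 : (r' ^ m) b = b := key hb ha (by rw [form_comm, hab])
    have := congrArg (fun f : Module.End ℝ (B → ℝ) => f b) hpow
    simpa [Module.End.mul_apply, h3] using this
  have hfix : ∀ v, form M a v = 0 → form M b v = 0 → (r ^ m) v = v := by
    intro v hav hbv
    have hr : r v = v := by simp [r, Module.End.mul_apply, reflection_apply, hav, hbv]
    generalize m = n
    induction n with
    | zero => simp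
    | succ n ih => rw [pow_succ, Module.End.mul_apply, hr, ih]
  ext1 v
  have hs2 : Real.sin θ ^ 2 ≠ 0 := by positivity
  have hsc := Real.sin_sq_add_cos_sq θ
  set c := Real.cos θ
  set x := (form M a v + c * form M b v) / Real.sin θ ^ 2 with hx
  set y := (form M b v + c * form M a v) / Real.sin θ ^ 2 with hy
  have hx' : x * (1 - c ^ 2) = form M a v + c * form M b v := by
    rw [show 1 - c ^ 2 = Real.sin θ ^ 2 by linarith, hx]; field_simp
  have hy' : y * (1 - c ^ 2) = form M b v + c * form M a v := by
    rw [show 1 - c ^ 2 = Real.sin θ ^ 2 by linarith, hy]; field_simp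
  have hc : 1 - c ^ 2 ≠ 0 := by rw [show 1 - c ^ 2 = Real.sin θ ^ 2 by linarith]; exact hs2
  have hv := hfix (v - x • a - y • b)
    (by
      simp only [map_sub, map_smul, smul_eq_mul, ha, hab]
      apply mul_right_cancel₀ hc
      linear_combination -hx' + c * hy')
    (by
      simp only [map_sub, map_smul, smul_eq_mul, hb, form_comm M b a, hab]
      apply mul_right_cancel₀ hc
      linear_combination -hy' + c * hx')
  simp only [map_sub, map_smul, h1, h2] at hv
  rw [Module.End.one_apply]
  linear_combination (exp := 1) hv

variable [DecidableEq B]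

/-- The simple root attached to a vertex of the Coxeter graph. -/
def simpleRoot (i : B) : B → ℝ := Pi.single i 1

theorem form_simpleRoot (M : CoxeterMatrix B) (i j : B) :
    form M (simpleRoot i) (simpleRoot j) = formEntry M i j := by
  simp [form_apply, bilin, simpleRoot, Pi.single_apply]

theorem form_simpleRoot_self (M : CoxeterMatrix B) (i : B) :
    form M (simpleRoot i) (simpleRoot i) = 1 := by
  rw [form_simpleRoot, formEntry_self]

theorem sum_smul_simpleRoot (v : B → ℝ) : ∑ i, v i • simpleRoot i = v := by
  ext j
  simp [simpleRoot, Finset.sum_apply, Pi.single_apply]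

theorem form_eq_sum (M : CoxeterMatrix B) (v w : B → ℝ) :
    form M v w = ∑ i, v i * form M (simpleRoot i) w := by
  conv_lhs => rw [← sum_smul_simpleRoot v]
  simp [LinearMap.sum_apply]

theorem isLiftable_reflection (M : CoxeterMatrix B) :
    M.IsLiftable fun i => reflection M (simpleRoot i) := by
  intro i j
  by_cases hij : i = j
  · subst hij
    rw [M.diagonal, pow_one, reflection_mul_self M (form_simpleRoot_self M i)]
  · by_cases h0 : M i j = 0
    · rw [h0, pow_zero]
    · refine reflection_mul_pow_eq_one M (form_simpleRoot_self M i) (form_simpleRoot_self M j) ?_ ?_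
      · have := M.off_diagonal i j hij
        omega
      · rw [form_simpleRoot, formEntry, if_neg h0]

variable [Group W] {M : CoxeterMatrix B} (cs : CoxeterSystem M W)

/-- The geometric representation of a Coxeter group. -/
noncomputable def geomRep : W →* Module.End ℝ (B → ℝ) :=
  cs.lift ⟨fun i => reflection M (simpleRoot i), isLiftable_reflection M⟩

theorem geomRep_simple (i : B) : geomRep cs (cs.simple i) = reflection M (simpleRoot i) :=
  cs.lift_apply_simple (isLiftable_reflection M) i

theorem geomRep_mul_apply (w w' : W) (v : B → ℝ) :
    geomRep cs (w * w') v = geomRep cs w (geomRep cs w' v) := by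
  rw [map_mul, Module.End.mul_apply]

theorem geomRep_inv_apply_self (w : W) (v : B → ℝ) :
    geomRep cs w⁻¹ (geomRep cs w v) = v := by
  rw [← geomRep_mul_apply]; simp

theorem geomRep_apply_inv_self (w : W) (v : B → ℝ) :
    geomRep cs w (geomRep cs w⁻¹ v) = v := by
  rw [← geomRep_mul_apply]; simp

theorem form_geomRep (w : W) (u v : B → ℝ) :
    form M (geomRep cs w u) (geomRep cs w v) = form M u v := by
  induction w using cs.simple_induction_left with
  | one => simp
  | mul_simple_left w i ih =>
    rw [geomRep_mul_apply, geomRep_mul_apply, geomRep_simple,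
      form_reflection M (form_simpleRoot_self M i), ih]

theorem geomRep_simple_apply_self (i : B) :
    geomRep cs (cs.simple i) (simpleRoot i) = -simpleRoot i := by
  rw [geomRep_simple, reflection_apply, form_simpleRoot_self]
  module

/-- A conjugate of a simple reflection acts as the reflection in the corresponding root. -/
theorem geomRep_conj_simple (w : W) (i : B) :
    geomRep cs (w * cs.simple i * w⁻¹) = reflection M (geomRep cs w (simpleRoot i)) := by
  refine LinearMap.ext fun v => ?_
  rw [geomRep_mul_apply, geomRep_mul_apply, geomRep_simple, reflection_apply, reflection_apply,
    map_sub, map_smul, geomRep_apply_inv_self]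
  congr 3
  rw [← form_geomRep cs w, geomRep_apply_inv_self]

end Representation

section Positivity

variable {B W : Type*} [Group W] {M : CoxeterMatrix B} (cs : CoxeterSystem M W)

/-- The Chebyshev-like sequence governing the action of a rank two standard parabolic subgroup
is nonnegative up to the order of the product of the two generators. -/
theorem exists_chebyshev_seq (M : CoxeterMatrix B) {i j : B} (hij : i ≠ j) :
    ∃ u : ℕ → ℝ, u 0 = 0 ∧ u 1 = 1 ∧
      (∀ k, u (k + 2) = 2 * (-formEntry M i j) * u (k + 1) - u k) ∧
      ∀ k, (M i j = 0 ∨ k ≤ M i j) → 0 ≤ u k := by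
  by_cases h0 : M i j = 0
  · refine ⟨fun k => k, by simp, by simp, fun k => ?_, fun k _ => by positivity⟩
    simp only [formEntry, h0, if_true]
    push_cast
    ring
  · have hm : 2 ≤ M i j := by
      have := M.off_diagonal i j hij
      omega
    have hm' : (2 : ℝ) ≤ M i j := by exact_mod_cast hm
    have hpi := Real.pi_pos
    set θ := Real.pi / (M i j : ℝ) with hθ
    have hmθ : (M i j : ℝ) * θ = Real.pi := by rw [hθ]; field_simp
    have hθ0 : 0 < θ := by positivity
    have hsin : 0 < Real.sin θ := Real.sin_pos_of_pos_of_lt_pi hθ0 (by nlinarith)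
    refine ⟨fun k => Real.sin (k * θ) / Real.sin θ, by simp, by simp [hsin.ne'], fun k => ?_,
      fun k hk => ?_⟩
    · rw [formEntry, if_neg h0, neg_neg]
      exact sin_mul_div_sin_recursion θ k
    · have hk' : (k : ℝ) ≤ M i j := by
        have := hk.resolve_left h0
        exact_mod_cast this
      refine div_nonneg (Real.sin_nonneg_of_nonneg_of_le_pi (by positivity) ?_) hsin.le
      rw [← hmθ]
      gcongr

/-- Any element `w` with a right descent `j` splits as `v * x`, lengths adding up, where `x` is an
alternating product of `i`, `j` and neither `i` nor `j` is a right descent of `v`. -/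
theorem exists_eq_mul_alternatingWord {w : W} {i j : B}
    (hj : cs.length (w * cs.simple j) < cs.length w) :
    ∃ (k : ℕ) (v : W), w = v * cs.wordProd (CoxeterSystem.alternatingWord i j k) ∧
      cs.length w = cs.length v + k ∧ 1 ≤ k ∧
      cs.length v < cs.length (v * cs.simple i) ∧ cs.length v < cs.length (v * cs.simple j) := by
  classical
  let P : ℕ → Prop := fun k => ∃ v : W,
    w = v * cs.wordProd (CoxeterSystem.alternatingWord i j k) ∧ cs.length w = cs.length v + k
  have hP1 : P 1 := by
    refine ⟨w * cs.simple j, by simp [CoxeterSystem.alternatingWord], ?_⟩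
    have := cs.length_mul_simple w j
    omega
  have hbound : ∀ k, P k → k ≤ cs.length w := fun k ⟨v, _, h⟩ => by omega
  set k := Nat.findGreatest P (cs.length w) with hk
  have hPk : P k := Nat.findGreatest_spec (hbound 1 hP1) hP1
  have hk1 : 1 ≤ k := Nat.le_findGreatest (hbound 1 hP1) hP1
  have hmax : ¬ P (k + 1) := fun h => by
    have := Nat.le_findGreatest (hbound _ h) h
    omega
  obtain ⟨v, hv, hlen⟩ := hPk
  obtain ⟨n, hn⟩ : ∃ n, k = n + 1 := ⟨k - 1, by omega⟩
  set f := if Even n then j else i with hf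
  set g := if Even k then j else i with hg
  have hlast : cs.length v < cs.length (v * cs.simple f) := by
    rcases cs.length_mul_simple v f with h | h
    · omega
    · exfalso
      have hw : w = (v * cs.simple f) * cs.wordProd (CoxeterSystem.alternatingWord i j n) := by
        rw [hv, hn, CoxeterSystem.alternatingWord_succ', cs.wordProd_cons, mul_assoc]
      have h1 := cs.length_mul_le (v * cs.simple f)
        (cs.wordProd (CoxeterSystem.alternatingWord i j n))
      have h2 := cs.length_wordProd_le (CoxeterSystem.alternatingWord i j n)
      rw [← hw] at h1
      rw [CoxeterSystem.length_alternatingWord] at h2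
      omega
  have hnext : cs.length v < cs.length (v * cs.simple g) := by
    rcases cs.length_mul_simple v g with h | h
    · omega
    · refine absurd ⟨v * cs.simple g, ?_, by omega⟩ hmax
      rw [CoxeterSystem.alternatingWord_succ', cs.wordProd_cons, mul_assoc,
        cs.simple_mul_simple_cancel_left]
      exact hv
  refine ⟨k, v, hv, hlen, hk1, ?_⟩
  by_cases hpar : Even n
  · have : ¬ Even k := by simpa [hn, Nat.even_add_one] using hpar
    rw [hf, if_pos hpar] at hlast
    rw [hg, if_neg this] at hnext
    exact ⟨hnext, hlast⟩
  · have : Even k := by simpa [hn, Nat.even_add_one] using hpar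
    rw [hf, if_neg hpar] at hlast
    rw [hg, if_pos this] at hnext
    exact ⟨hlast, hnext⟩

/-- If a reduced product `v * x` with `x` alternating in `i`, `j` (ending in `j`) does not
have `i` as a right descent, then `x` is shorter than the order of `s i * s j`. -/
theorem alternatingWord_length_lt {v w : W} {i j : B} {k : ℕ}
    (hw : w = v * cs.wordProd (CoxeterSystem.alternatingWord i j k))
    (hlen : cs.length w = cs.length v + k) (hi : cs.length w < cs.length (w * cs.simple i)) :
    M i j = 0 ∨ k + 1 ≤ M i j := by
  by_contra! hcon
  obtain ⟨hm0, hmk⟩ := hcon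
  set m := M i j with hm
  have hsplit : ∀ n, cs.wordProd (CoxeterSystem.alternatingWord i j (n + m)) =
      cs.wordProd (if Even m then CoxeterSystem.alternatingWord i j n
        else CoxeterSystem.alternatingWord j i n) *
      cs.wordProd (CoxeterSystem.alternatingWord i j m) := by
    intro n
    induction n with
    | zero => simp [CoxeterSystem.alternatingWord]
    | succ n ih =>
      rw [show n + 1 + m = (n + m) + 1 by ring, CoxeterSystem.alternatingWord_succ',
        cs.wordProd_cons, ih, CoxeterSystem.alternatingWord_succ',
        CoxeterSystem.alternatingWord_succ']
      by_cases h : Even m <;> by_cases h' : Even n <;>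
        simp [h, h', Nat.even_add, cs.wordProd_cons, mul_assoc]
  obtain ⟨n, rfl⟩ : ∃ n, k = n + m := ⟨k - m, by omega⟩
  obtain ⟨m', hm'⟩ : ∃ m', m = m' + 1 := ⟨m - 1, by omega⟩
  have hbraid : cs.wordProd (CoxeterSystem.alternatingWord i j m) =
      cs.wordProd (CoxeterSystem.alternatingWord j i m) := by
    rw [cs.prod_alternatingWord_eq_prod_alternatingWord_sub i j m (by omega)]
    congr 2
    omega
  rw [hsplit, hbraid, hm', CoxeterSystem.alternatingWord_succ, List.concat_eq_append,
    cs.wordProd_append, cs.wordProd_singleton] at hw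
  have hwi : w * cs.simple i = v * cs.wordProd ((if Even m then CoxeterSystem.alternatingWord i j n
      else CoxeterSystem.alternatingWord j i n) ++ CoxeterSystem.alternatingWord i j m') := by
    rw [hw, cs.wordProd_append, hm']
    simp [mul_assoc]
  have h1 := cs.length_mul_le v (cs.wordProd ((if Even m then CoxeterSystem.alternatingWord i j n
      else CoxeterSystem.alternatingWord j i n) ++ CoxeterSystem.alternatingWord i j m'))
  have h2 := cs.length_wordProd_le ((if Even m then CoxeterSystem.alternatingWord i j n
      else CoxeterSystem.alternatingWord j i n) ++ CoxeterSystem.alternatingWord i j m')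
  rw [← hwi] at h1
  have h3 : ((if Even m then CoxeterSystem.alternatingWord i j n
      else CoxeterSystem.alternatingWord j i n) ++
      CoxeterSystem.alternatingWord i j m').length = n + m' := by
    split_ifs <;> simp
  omega

variable [Fintype B] [DecidableEq B]

theorem geomRep_alternatingWord {i j : B} {u : ℕ → ℝ} (h0 : u 0 = 0) (h1 : u 1 = 1)
    (hu : ∀ k, u (k + 2) = 2 * (-formEntry M i j) * u (k + 1) - u k) (k : ℕ) :
    geomRep cs (cs.wordProd (CoxeterSystem.alternatingWord i j k)) (simpleRoot i) =
      if Even k then u (k + 1) • simpleRoot i + u k • simpleRoot j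
      else u (k + 1) • simpleRoot j + u k • simpleRoot i := by
  induction k with
  | zero => simp [CoxeterSystem.alternatingWord, h0, h1]
  | succ k ih =>
    rw [CoxeterSystem.alternatingWord_succ', cs.wordProd_cons, geomRep_mul_apply, ih,
      geomRep_simple]
    by_cases hk : Even k
    · have hk' : ¬ Even (k + 1) := by simpa [Nat.even_add_one] using hk
      simp only [hk, hk', if_true, if_false, reflection_apply, map_add, map_smul,
        form_simpleRoot, formEntry_self, formEntry_comm M j i, hu k]
      module
    · have hk' : Even (k + 1) := by simpa [Nat.even_add_one] using hk
      simp only [hk, hk', if_true, if_false, reflection_apply, map_add, map_smul,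
        form_simpleRoot, formEntry_self, hu k]
      module

/-- Tits: if `i` is not a right descent of `w`, then `w` maps the simple root of `i` to a
nonnegative vector. -/
theorem geomRep_simpleRoot_nonneg {w : W} {i : B}
    (hi : cs.length w < cs.length (w * cs.simple i)) :
    0 ≤ geomRep cs w (simpleRoot i) := by
  induction hn : cs.length w using Nat.strong_induction_on generalizing w i with
  | _ n ih =>
    by_cases hw1 : w = 1
    · subst hw1
      simp [simpleRoot]
    obtain ⟨j, hj⟩ := cs.exists_rightDescent_of_ne_one hw1
    have hij : i ≠ j := by
      rintro rfl
      exact absurd hj (by simp only [CoxeterSystem.IsRightDescent]; omega)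
    obtain ⟨k, v, hwv, hlen, hk1, hvi, hvj⟩ := exists_eq_mul_alternatingWord cs (i := i) hj
    have hkm := alternatingWord_length_lt cs hwv hlen hi
    obtain ⟨u, h0, h1, hrec, hpos⟩ := exists_chebyshev_seq M hij
    have hu1 := hpos (k + 1) hkm
    have hu0 := hpos k (hkm.imp_right fun h => by omega)
    have hPi := ih _ (by omega) hvi rfl
    have hPj := ih _ (by omega) hvj rfl
    rw [hwv, geomRep_mul_apply, geomRep_alternatingWord cs h0 h1 hrec]
    split_ifs <;> rw [map_add, map_smul, map_smul] <;>
      exact add_nonneg (smul_nonneg (by assumption) (by assumption))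
        (smul_nonneg (by assumption) (by assumption))

theorem geomRep_simpleRoot_nonpos {w : W} {i : B}
    (hi : cs.length (w * cs.simple i) < cs.length w) :
    geomRep cs w (simpleRoot i) ≤ 0 := by
  have h := geomRep_simpleRoot_nonneg cs (w := w * cs.simple i) (i := i)
    (by rwa [cs.simple_mul_simple_cancel_right])
  rw [geomRep_mul_apply, geomRep_simple_apply_self, map_neg] at h
  exact neg_nonneg.mp h

theorem geomRep_simpleRoot_nonneg_or_nonpos (w : W) (i : B) :
    0 ≤ geomRep cs w (simpleRoot i) ∨ geomRep cs w (simpleRoot i) ≤ 0 := by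
  rcases cs.length_mul_simple w i with h | h
  · exact Or.inl (geomRep_simpleRoot_nonneg cs (by omega))
  · exact Or.inr (geomRep_simpleRoot_nonpos cs (by omega))

theorem exists_geomRep_simpleRoot_nonpos {w : W} (hw : w ≠ 1) :
    ∃ i, geomRep cs w (simpleRoot i) ≤ 0 := by
  obtain ⟨i, hi⟩ := cs.exists_rightDescent_of_ne_one hw
  exact ⟨i, geomRep_simpleRoot_nonpos cs hi⟩

theorem geomRep_injective : Function.Injective (geomRep cs) := by
  refine (injective_iff_map_eq_one _).mpr fun w hw => ?_
  by_contra hne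
  obtain ⟨i, hi⟩ := exists_geomRep_simpleRoot_nonpos cs hne
  have := hi i
  rw [hw] at this
  simp [simpleRoot] at this
  linarith

end Positivity

section Discreteness

variable {B W : Type*} [Fintype B]

theorem exists_pos_mul_norm_sq_le_form (M : CoxeterMatrix B) (U : Submodule ℝ (B → ℝ))
    (hU : ∀ v ∈ U, v ≠ 0 → 0 < form M v v) :
    ∃ c : ℝ, 0 < c ∧ ∀ v ∈ U, c * ‖v‖ ^ 2 ≤ form M v v := by
  have hcont : Continuous fun v : B → ℝ => form M v v := by
    simp only [form_apply, bilin]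
    fun_prop
  have hcomp : IsCompact ((U : Set (B → ℝ)) ∩ Metric.sphere 0 1) :=
    (isCompact_sphere _ _).inter_left U.closed_of_finiteDimensional
  obtain hemp | hne := ((U : Set (B → ℝ)) ∩ Metric.sphere 0 1).eq_empty_or_nonempty
  · refine ⟨1, one_pos, fun v hv => ?_⟩
    by_cases h0 : v = 0
    · simp [h0]
    · have : ‖v‖⁻¹ • v ∈ (U : Set (B → ℝ)) ∩ Metric.sphere 0 1 :=
        ⟨U.smul_mem _ hv, by simp [norm_smul, h0]⟩
      simp [hemp] at this
  · obtain ⟨u, ⟨huU, hu1⟩, hmin⟩ := hcomp.exists_isMinOn hne hcont.continuousOn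
    have hu0 : u ≠ 0 := by
      rintro rfl
      simp at hu1
    refine ⟨form M u u, hU u huU hu0, fun v hv => ?_⟩
    by_cases h0 : v = 0
    · simp [h0]
    · have hv0 : ‖v‖ ≠ 0 := by simpa using h0
      have h1 : form M u u ≤ form M (‖v‖⁻¹ • v) (‖v‖⁻¹ • v) :=
        hmin (⟨U.smul_mem _ hv, by simp [norm_smul, h0]⟩ :
          ‖v‖⁻¹ • v ∈ (U : Set (B → ℝ)) ∩ Metric.sphere 0 1)
      simp only [map_smul, LinearMap.smul_apply, smul_eq_mul] at h1
      calc form M u u * ‖v‖ ^ 2 ≤ (‖v‖⁻¹ * (‖v‖⁻¹ * form M v v)) * ‖v‖ ^ 2 := by gcongr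
        _ = form M v v := by field_simp

variable [DecidableEq B] [Group W] {M : CoxeterMatrix B} (cs : CoxeterSystem M W)

/-- The image of the geometric representation is uniformly discrete: only finitely many elements
have matrix entries (and matrix entries of the inverse) below a given bound. -/
theorem finite_setOf_geomRep_bounded {C : ℝ} (hC : 0 ≤ C) :
    {w : W | ∀ i, ‖geomRep cs w (simpleRoot i)‖ ≤ C ∧
      ‖geomRep cs w⁻¹ (simpleRoot i)‖ ≤ C}.Finite := by
  set S := {w : W | ∀ i, ‖geomRep cs w (simpleRoot i)‖ ≤ C ∧
      ‖geomRep cs w⁻¹ (simpleRoot i)‖ ≤ C} with hS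
  let F : W → B → B → ℝ := fun w i => geomRep cs w (simpleRoot i)
  have hbdd : TotallyBounded (F '' S) := by
    refine ((isCompact_closedBall (0 : B → B → ℝ) C).totallyBounded).subset ?_
    rintro _ ⟨w, hw, rfl⟩
    rw [mem_closedBall_zero_iff, pi_norm_le_iff_of_nonneg hC]
    exact fun i => (hw i).1
  set n : ℝ := (Fintype.card B : ℝ) with hn
  have hn0 : 0 ≤ n := by positivity
  set ε : ℝ := 1 / (2 * (n * C + 1)) with hε
  have hε0 : 0 < ε := by positivity
  have hclose : ∀ w₁ ∈ S, ∀ w₂ ∈ S, dist (F w₁) (F w₂) < 2 * ε → w₁ = w₂ := by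
    intro w₁ h₁ w₂ h₂ hd
    by_contra hne
    have hne' : w₁⁻¹ * w₂ ≠ 1 := fun h => hne (inv_mul_eq_one.mp h)
    obtain ⟨i, hi⟩ := exists_geomRep_simpleRoot_nonpos cs hne'
    set d := F w₂ i - F w₁ i with hd'
    have hdn : ‖d‖ < 2 * ε := by
      rw [hd', ← dist_eq_norm, dist_comm]
      exact (dist_le_pi_dist _ _ i).trans_lt hd
    have heq : geomRep cs (w₁⁻¹ * w₂) (simpleRoot i) =
        simpleRoot i + ∑ j, d j • geomRep cs w₁⁻¹ (simpleRoot j) := by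
      have h3 : geomRep cs w₁⁻¹ d = ∑ j, d j • geomRep cs w₁⁻¹ (simpleRoot j) := by
        conv_lhs => rw [← sum_smul_simpleRoot d]
        simp
      rw [← h3, hd', map_sub, geomRep_mul_apply]
      simp only [F, geomRep_inv_apply_self]
      module
    have hsum : ‖∑ j, d j • geomRep cs w₁⁻¹ (simpleRoot j)‖ ≤ n * (2 * ε * C) := by
      refine (norm_sum_le _ _).trans ?_
      rw [hn, ← nsmul_eq_mul]
      refine Finset.sum_le_card_nsmul _ _ _ fun j _ => ?_
      rw [norm_smul]
      exact mul_le_mul ((norm_le_pi_norm d j).trans hdn.le) (h₁ j).2 (norm_nonneg _) (by positivity)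
    have hlt : n * (2 * ε * C) < 1 := by
      rw [hε]
      have : 0 < n * C + 1 := by positivity
      rw [show n * (2 * (1 / (2 * (n * C + 1))) * C) = n * C / (n * C + 1) by field_simp]
      rw [div_lt_one this]
      linarith
    have hcoord := hi i
    rw [heq] at hcoord
    have h4 := (norm_le_pi_norm (∑ j, d j • geomRep cs w₁⁻¹ (simpleRoot j)) i).trans hsum
    rw [Real.norm_eq_abs] at h4
    have h5 := (abs_le.mp h4).1
    have h6 : (simpleRoot i : B → ℝ) i = 1 := by simp [simpleRoot]
    simp only [Pi.add_apply, Pi.zero_apply, h6] at hcoord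
    linarith
  obtain ⟨t, ht, hcover⟩ := Metric.totallyBounded_iff.mp hbdd ε hε0
  have hsub : S ⊆ ⋃ y ∈ t, {w ∈ S | F w ∈ Metric.ball y ε} := by
    intro w hw
    obtain ⟨y, hy, hwy⟩ := Set.mem_iUnion₂.mp (hcover ⟨w, hw, rfl⟩)
    exact Set.mem_iUnion₂.mpr ⟨y, hy, hw, hwy⟩
  refine (ht.biUnion fun y _ => Set.Subsingleton.finite ?_).subset hsub
  rintro w₁ ⟨h₁, hb₁⟩ w₂ ⟨h₂, hb₂⟩
  refine hclose w₁ h₁ w₂ h₂ ?_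
  calc dist (F w₁) (F w₂) ≤ dist (F w₁) y + dist (F w₂) y := dist_triangle_right _ _ _
    _ < 2 * ε := by rw [Metric.mem_ball] at hb₁ hb₂; linarith

/-- If the form is positive semidefinite, and positive definite on a subspace `U`, then only
finitely many elements of the Coxeter group act trivially modulo `U`. -/
theorem finite_setOf_geomRep_sub_mem (hpsd : IsPosSemidef M) (U : Submodule ℝ (B → ℝ))
    (hU : ∀ v ∈ U, v ≠ 0 → 0 < form M v v) :
    {w : W | ∀ v, geomRep cs w v - v ∈ U}.Finite := by
  obtain ⟨c, hc, hcU⟩ := exists_pos_mul_norm_sq_le_form M U hU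
  have hbound : ∀ w : W, (∀ v, geomRep cs w v - v ∈ U) → ∀ i,
      ‖geomRep cs w (simpleRoot i)‖ ≤ Real.sqrt (4 / c) + 1 := by
    intro w hw i
    set a := simpleRoot (B := B) i
    set b := geomRep cs w a with hb
    have haa : form M a a = 1 := form_simpleRoot_self M i
    have hbb : form M b b = 1 := by rw [hb, form_geomRep, haa]
    have h1 : 0 ≤ form M (b + a) (b + a) := hpsd _
    have h2 := hcU _ (hw a)
    simp only [map_add, map_sub, LinearMap.add_apply, LinearMap.sub_apply, ← hb, haa, hbb,
      form_comm M a b] at h1 h2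
    have h3 : ‖b - a‖ ≤ Real.sqrt (4 / c) := by
      apply Real.le_sqrt_of_sq_le
      rw [le_div_iff₀ hc]
      linarith
    have h4 : ‖a‖ ≤ 1 := by
      rw [pi_norm_le_iff_of_nonneg zero_le_one]
      intro j
      simp only [a, simpleRoot, Pi.single_apply]
      split_ifs <;> simp
    calc ‖b‖ = ‖(b - a) + a‖ := by rw [sub_add_cancel]
      _ ≤ ‖b - a‖ + ‖a‖ := norm_add_le _ _
      _ ≤ _ := add_le_add h3 h4
  refine (finite_setOf_geomRep_bounded cs (C := Real.sqrt (4 / c) + 1) (by positivity)).subset ?_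
  intro w hw i
  refine ⟨hbound w hw i, hbound w⁻¹ (fun v => ?_) i⟩
  have h := U.neg_mem (hw (geomRep cs w⁻¹ v))
  rwa [geomRep_apply_inv_self, neg_sub] at h

theorem finite_of_isPosDef (cs : CoxeterSystem M W) (hpd : IsPosDef M) : Finite W := by
  have hpsd : IsPosSemidef M := fun v => by
    by_cases h : v = 0
    · simp [h, bilin]
    · exact (hpd v h).le
  have h := finite_setOf_geomRep_sub_mem cs hpsd ⊤ fun v _ hv => hpd v hv
  simpa [Set.finite_univ_iff] using h

end Discreteness

section Irreducible

variable {B : Type*} {M : CoxeterMatrix B}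

theorem formEntry_ne_zero_of_adj {i j : B} (h : (coxeterGraph M).Adj i j) :
    i ≠ j ∧ formEntry M i j ≠ 0 := by
  rw [coxeterGraph, SimpleGraph.fromRel_adj, M.symmetric j i, or_self] at h
  refine ⟨h.1, ?_⟩
  unfold formEntry
  split_ifs with h0
  · norm_num
  · have h1 := M.off_diagonal i j h.1
    have h3 : (3 : ℝ) ≤ M i j := by
      have : 3 ≤ M i j := by have := h.2; omega
      exact_mod_cast this
    have hpi := Real.pi_pos
    have hle : Real.pi / (M i j : ℝ) ≤ Real.pi / 3 :=
      div_le_div_of_nonneg_left hpi.le (by norm_num) h3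
    have : 0 < Real.pi / (M i j : ℝ) := by positivity
    have := Real.cos_pos_of_mem_Ioo (x := Real.pi / (M i j : ℝ)) ⟨by linarith, by linarith⟩
    linarith

/-- Propagation of a property through the (connected) Coxeter graph. -/
theorem IsIrreducible.forall_of_exists (hirr : IsIrreducible M) {P : B → Prop}
    (hstep : ∀ i j, i ≠ j → formEntry M i j ≠ 0 → P i → P j) {i₀ : B} (h₀ : P i₀) (j : B) :
    P j := by
  obtain ⟨p⟩ := hirr.preconnected i₀ j
  induction p with
  | nil => exact h₀
  | cons hadj _ ih =>
    have := formEntry_ne_zero_of_adj hadj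
    exact ih (hstep _ _ this.1 this.2 h₀)

variable [Fintype B]

theorem IsPosSemidef.form_eq_zero (hpsd : IsPosSemidef M) {v : B → ℝ} (hv : form M v v = 0)
    (u : B → ℝ) : form M u v = 0 := by
  by_contra hne
  obtain ⟨t, ht⟩ : ∃ t : ℝ, t * (2 * form M u v) = -(form M u u + 1) :=
    ⟨_, div_mul_cancel₀ _ (mul_ne_zero two_ne_zero hne)⟩
  have h : 0 ≤ form M (u + t • v) (u + t • v) := hpsd _
  simp only [map_add, map_smul, LinearMap.add_apply, LinearMap.smul_apply, smul_eq_mul, hv,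
    form_comm M v u] at h
  linarith

theorem IsPosSemidef.abs_form_le_one (hpsd : IsPosSemidef M) {a b : B → ℝ} (ha : form M a a = 1)
    (hb : form M b b = 1) : |form M a b| ≤ 1 := by
  have h1 : 0 ≤ form M (a + b) (a + b) := hpsd _
  have h2 : 0 ≤ form M (a - b) (a - b) := hpsd _
  simp only [map_add, map_sub, LinearMap.add_apply, LinearMap.sub_apply, ha, hb,
    form_comm M b a] at h1 h2
  rw [abs_le]
  constructor <;> linarith

variable [DecidableEq B]

theorem IsPosSemidef.form_abs_eq_zero (hpsd : IsPosSemidef M) {v : B → ℝ}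
    (hv : form M v v = 0) : form M |v| |v| = 0 := by
  refine le_antisymm (hv ▸ ?_) (hpsd _)
  simp only [form_apply, bilin]
  refine Finset.sum_le_sum fun i _ => Finset.sum_le_sum fun j _ => ?_
  by_cases hij : i = j
  · subst hij
    simp [formEntry_self]
  · refine mul_le_mul_of_nonpos_right ?_ (formEntry_nonpos M hij)
    rw [Pi.abs_apply, Pi.abs_apply, ← abs_mul]
    exact le_abs_self _

/-- Perron-Frobenius: an isotropic vector of an irreducible semidefinite form has no zero
coordinate. -/
theorem IsPosSemidef.ne_zero_of_isotropic (hpsd : IsPosSemidef M) (hirr : IsIrreducible M)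
    {v : B → ℝ} (hv : form M v v = 0) (hv0 : v ≠ 0) (i : B) : v i ≠ 0 := by
  intro hi
  refine hv0 (funext fun j => ?_)
  refine hirr.forall_of_exists (P := fun i => v i = 0) (fun i j hij hne hvi => ?_) hi j
  have h := hpsd.form_eq_zero (hpsd.form_abs_eq_zero hv) (simpleRoot i)
  rw [form_comm, form_eq_sum] at h
  have hnonpos : ∀ k ∈ Finset.univ, |v| k * form M (simpleRoot k) (simpleRoot i) ≤ 0 := by
    intro k _
    rw [form_simpleRoot]
    by_cases hki : k = i
    · subst hki
      simp [hvi]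
    · exact mul_nonpos_of_nonneg_of_nonpos (abs_nonneg _) (formEntry_nonpos M hki)
  have h2 := (Finset.sum_eq_zero_iff_of_nonpos hnonpos).mp h j (Finset.mem_univ j)
  rw [form_simpleRoot, formEntry_comm] at h2
  simpa [hne] using h2

theorem IsPosSemidef.exists_pos_isotropic (hpsd : IsPosSemidef M) (hirr : IsIrreducible M)
    (hpd : ¬ IsPosDef M) : ∃ δ : B → ℝ, (∀ i, 0 < δ i) ∧ form M δ δ = 0 := by
  simp only [IsPosDef, not_forall] at hpd
  obtain ⟨v, hv0, hv⟩ := hpd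
  have hvv : form M v v = 0 := le_antisymm (not_lt.mp hv) (hpsd v)
  exact ⟨|v|, fun i => abs_pos.mpr (hpsd.ne_zero_of_isotropic hirr hvv hv0 i),
    hpsd.form_abs_eq_zero hvv⟩

end Irreducible

section Roots

variable {B W : Type*} [Fintype B] [DecidableEq B] [Group W] {M : CoxeterMatrix B}
  (cs : CoxeterSystem M W)

/-- The roots: images of the simple roots under the geometric representation. -/
def roots : Set (B → ℝ) := {b | ∃ w i, b = geomRep cs w (simpleRoot i)}

variable {cs}

theorem form_self_of_mem_roots {b : B → ℝ} (hb : b ∈ roots cs) : form M b b = 1 := by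
  obtain ⟨w, i, rfl⟩ := hb
  rw [form_geomRep, form_simpleRoot_self]

theorem geomRep_mem_roots {b : B → ℝ} (hb : b ∈ roots cs) (w : W) :
    geomRep cs w b ∈ roots cs := by
  obtain ⟨w', i, rfl⟩ := hb
  exact ⟨w * w', i, (geomRep_mul_apply cs _ _ _).symm⟩

theorem simpleRoot_mem_roots (i : B) : simpleRoot i ∈ roots cs := ⟨1, i, by simp⟩

theorem nonneg_or_nonpos_of_mem_roots {b : B → ℝ} (hb : b ∈ roots cs) : 0 ≤ b ∨ b ≤ 0 := by
  obtain ⟨w, i, rfl⟩ := hb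
  exact geomRep_simpleRoot_nonneg_or_nonpos cs w i

theorem exists_geomRep_eq_reflection {b : B → ℝ} (hb : b ∈ roots cs) :
    ∃ t : W, geomRep cs t = reflection M b := by
  obtain ⟨w, i, rfl⟩ := hb
  exact ⟨_, geomRep_conj_simple cs w i⟩

/-- A simple reflection permutes the positive roots other than its own simple root. -/
theorem geomRep_simple_nonneg {b : B → ℝ} (hb : b ∈ roots cs) (hb0 : 0 ≤ b) {i : B}
    (hbi : b ≠ simpleRoot i) : 0 ≤ geomRep cs (cs.simple i) b := by
  obtain ⟨j, hji, hj⟩ : ∃ j, j ≠ i ∧ b j ≠ 0 := by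
    by_contra! hcon
    have hbe : b = b i • simpleRoot i := by
      ext j
      by_cases hji : j = i
      · subst hji
        simp [simpleRoot]
      · simp [simpleRoot, hji, hcon j hji]
    have h1 := form_self_of_mem_roots hb
    rw [hbe] at h1
    simp only [map_smul, LinearMap.smul_apply, form_simpleRoot_self, smul_eq_mul, mul_one] at h1
    have h2 : b i = 1 := by have := hb0 i; simp only [Pi.zero_apply] at this; nlinarith
    exact hbi (by rw [hbe, h2, one_smul])
  have hj' : 0 < b j := lt_of_le_of_ne (hb0 j) hj.symm
  refine (nonneg_or_nonpos_of_mem_roots (geomRep_mem_roots hb (cs.simple i))).resolve_right ?_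
  intro h
  have := h j
  simp [geomRep_simple, reflection_apply, simpleRoot, hji] at this
  linarith

theorem finite_setOf_nonneg_geomRep_nonpos (w : W) :
    {b ∈ roots cs | 0 ≤ b ∧ geomRep cs w b ≤ 0}.Finite := by
  induction w using cs.simple_induction_left with
  | one =>
    refine Set.Finite.subset Set.finite_empty ?_
    rintro b ⟨hb, h0, h1⟩
    have hb0 : b = 0 := le_antisymm (by simpa using h1) h0
    have := form_self_of_mem_roots hb
    simp [hb0] at this
  | mul_simple_left w i ih =>
    refine (ih.union (Set.finite_singleton (geomRep cs w⁻¹ (simpleRoot i)))).subset ?_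
    rintro b ⟨hb, h0, h1⟩
    by_cases hwb : geomRep cs w b ≤ 0
    · exact Or.inl ⟨hb, h0, hwb⟩
    · right
      have hwb' := (nonneg_or_nonpos_of_mem_roots (geomRep_mem_roots hb w)).resolve_right hwb
      by_contra hne
      have hne' : geomRep cs w b ≠ simpleRoot i := by
        intro h
        apply hne
        rw [Set.mem_singleton_iff, ← h, geomRep_inv_apply_self]
      have h2 := geomRep_simple_nonneg (geomRep_mem_roots hb w) hwb' hne'
      rw [geomRep_mul_apply] at h1
      have h3 : geomRep cs (cs.simple i) (geomRep cs w b) = 0 := le_antisymm h1 h2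
      have h4 := form_self_of_mem_roots
        (geomRep_mem_roots (geomRep_mem_roots hb w) (cs.simple i))
      simp [h3] at h4

/-- A functional which is negative on only finitely many positive roots can be moved into the
fundamental chamber. -/
theorem exists_dominant (x : Module.Dual ℝ (B → ℝ))
    (hx : {b ∈ roots cs | 0 ≤ b ∧ x b < 0}.Finite) :
    ∃ w, ∀ i, 0 ≤ x (geomRep cs w (simpleRoot i)) := by
  induction hn : {b ∈ roots cs | 0 ≤ b ∧ x b < 0}.ncard using Nat.strong_induction_on
    generalizing x with
  | _ n ih =>
    by_cases hdom : ∀ i, 0 ≤ x (simpleRoot i)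
    · exact ⟨1, by simpa using hdom⟩
    push Not at hdom
    obtain ⟨i, hi⟩ := hdom
    set N := {b ∈ roots cs | 0 ≤ b ∧ x b < 0} with hN
    have hiN : simpleRoot i ∈ N :=
      ⟨simpleRoot_mem_roots i, by simp [simpleRoot], hi⟩
    set x' : Module.Dual ℝ (B → ℝ) := x.comp (geomRep cs (cs.simple i)) with hx'
    have hsub : {b ∈ roots cs | 0 ≤ b ∧ x' b < 0} ⊆
        geomRep cs (cs.simple i) '' (N \ {simpleRoot i}) := by
      rintro b ⟨hb, h0, h1⟩
      have hxb : x (geomRep cs (cs.simple i) b) < 0 := h1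
      have hbi : b ≠ simpleRoot i := by
        rintro rfl
        rw [geomRep_simple_apply_self, map_neg] at hxb
        linarith
      have hinv : geomRep cs (cs.simple i) (geomRep cs (cs.simple i) b) = b := by
        rw [← geomRep_mul_apply]; simp
      refine ⟨geomRep cs (cs.simple i) b,
        ⟨⟨geomRep_mem_roots hb _, geomRep_simple_nonneg hb h0 hbi, hxb⟩, ?_⟩, hinv⟩
      intro h
      rw [Set.mem_singleton_iff] at h
      rw [h, geomRep_simple_apply_self] at hinv
      have := h0 i
      rw [← hinv] at this
      simp [simpleRoot] at this
      linarith
    have hfin : (N \ {simpleRoot i}).Finite := hx.subset Set.sdiff_subset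
    have hcard : {b ∈ roots cs | 0 ≤ b ∧ x' b < 0}.ncard < n := by
      calc _ ≤ (geomRep cs (cs.simple i) '' (N \ {simpleRoot i})).ncard :=
            Set.ncard_le_ncard hsub (hfin.image _)
        _ ≤ (N \ {simpleRoot i}).ncard := Set.ncard_image_le hfin
        _ < N.ncard := Set.ncard_sdiff_singleton_lt_of_mem hiN hx
        _ = n := hn
    obtain ⟨w, hw⟩ := ih _ hcard x' ((hfin.image _).subset hsub) rfl
    refine ⟨cs.simple i * w, fun j => ?_⟩
    rw [geomRep_mul_apply]
    exact hw j

end Roots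

section Affine

variable {B W : Type*} [Fintype B] [DecidableEq B] [Group W] {M : CoxeterMatrix B}
  {cs : CoxeterSystem M W}

theorem geomRep_apply_of_radical {v : B → ℝ} (hv : ∀ u, form M u v = 0) (w : W) :
    geomRep cs w v = v := by
  induction w using cs.simple_induction_left with
  | one => simp
  | mul_simple_left w i ih =>
    rw [geomRep_mul_apply, ih, geomRep_simple, reflection_apply, hv]
    simp

/-- Two non-proportional roots of an affine Coxeter group can be moved simultaneously into a
proper standard parabolic root subsystem. -/
theorem exists_geomRep_coord_eq_zero (hpsd : IsPosSemidef M) {δ : B → ℝ} (hδ : ∀ i, 0 < δ i)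
    (hδδ : form M δ δ = 0) (hne : Nonempty B) {b c : B → ℝ} (hb : b ∈ roots cs)
    (hc : c ∈ roots cs) (hbc : |form M b c| < 1) :
    ∃ (w : W) (i : B), geomRep cs w b i = 0 ∧ geomRep cs w c i = 0 := by
  have hbb := form_self_of_mem_roots hb
  have hcc := form_self_of_mem_roots hc
  set U : Submodule ℝ (B → ℝ) := Submodule.span ℝ {b, c} with hU
  have hbU : b ∈ U := Submodule.subset_span (by simp)
  have hcU : c ∈ U := Submodule.subset_span (by simp)
  have hpos : ∀ v ∈ U, v ≠ 0 → 0 < form M v v := by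
    intro v hv hv0
    obtain ⟨x, y, rfl⟩ := Submodule.mem_span_pair.mp hv
    have hxy : 0 < x ^ 2 + y ^ 2 := by
      by_contra hcon
      have hx : x = 0 := by nlinarith [sq_nonneg x, sq_nonneg y]
      have hy : y = 0 := by nlinarith [sq_nonneg x, sq_nonneg y]
      simp [hx, hy] at hv0
    simp only [map_add, map_smul, LinearMap.add_apply, LinearMap.smul_apply, smul_eq_mul, hbb,
      hcc, form_comm M c b]
    obtain ⟨h1, h2⟩ := abs_lt.mp hbc
    nlinarith [mul_nonneg (sub_nonneg.mpr h2.le) (sq_nonneg (x - y)),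
      mul_nonneg (neg_le_iff_add_nonneg.mp h1.le) (sq_nonneg (x + y)),
      mul_pos (sub_pos.mpr h2) hxy, mul_pos (neg_lt_iff_pos_add.mp h1) hxy]
  have hDfin := finite_setOf_geomRep_sub_mem cs hpsd U hpos
  set D := hDfin.toFinset with hD
  have hmemD : ∀ w, w ∈ D ↔ ∀ v, geomRep cs w v - v ∈ U := fun w => by simp [hD]
  let p : Module.Dual ℝ (B → ℝ) := ∑ j, LinearMap.proj j
  have hp : ∀ v, p v = ∑ j, v j := fun v => by simp [p, LinearMap.sum_apply]
  let x : Module.Dual ℝ (B → ℝ) := ∑ d ∈ D, p.comp (geomRep cs d)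
  have hx : ∀ v, x v = ∑ d ∈ D, p (geomRep cs d v) := fun v => by
    simp [x, LinearMap.sum_apply]
  have hfix : ∀ a ∈ roots cs, a ∈ U → x a = 0 := by
    intro a ha haU
    obtain ⟨t, ht⟩ := exists_geomRep_eq_reflection ha
    have haa := form_self_of_mem_roots ha
    have htt : t * t = 1 := geomRep_injective cs (by
      rw [map_mul, map_one, ht, reflection_mul_self M haa])
    have hmem : ∀ d ∈ D, d * t ∈ D := by
      intro d hd
      rw [hmemD] at hd ⊢
      intro v
      have h1 := hd (geomRep cs t v)
      have h2 : geomRep cs t v - v ∈ U := by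
        rw [ht, reflection_apply, sub_sub_cancel_left]
        exact U.neg_mem (U.smul_mem _ haU)
      have h3 := U.add_mem h1 h2
      rwa [sub_add_sub_cancel, ← geomRep_mul_apply] at h3
    have hta : geomRep cs t a = -a := by
      rw [ht, reflection_apply, haa]
      module
    have h1 : x a = x (geomRep cs t a) := by
      rw [hx, hx]
      refine Finset.sum_nbij' (· * t) (· * t) hmem hmem ?_ ?_ ?_
      · intro d _
        simp [mul_assoc, htt]
      · intro d _
        simp [mul_assoc, htt]
      · intro d _
        rw [← geomRep_mul_apply, mul_assoc, htt, mul_one]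
    rw [hta, map_neg] at h1
    linarith
  have hneg : {a ∈ roots cs | 0 ≤ a ∧ x a < 0}.Finite := by
    refine (D.finite_toSet.biUnion fun d _ =>
      finite_setOf_nonneg_geomRep_nonpos (cs := cs) d).subset ?_
    rintro a ⟨ha, ha0, hxa⟩
    rw [hx] at hxa
    obtain ⟨d, hd, hda⟩ := Finset.exists_lt_of_sum_lt
      (s := D) (f := fun d => p (geomRep cs d a)) (g := fun _ => 0) (by simpa using hxa)
    refine Set.mem_iUnion₂.mpr ⟨d, hd, ha, ha0, ?_⟩
    refine (nonneg_or_nonpos_of_mem_roots (geomRep_mem_roots ha d)).resolve_left fun h => ?_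
    rw [hp] at hda
    exact absurd (Finset.sum_nonneg fun j _ => h j) (not_le.mpr hda)
  obtain ⟨w, hw⟩ := exists_dominant x hneg
  have hxsum : ∀ v, x (geomRep cs w v) = ∑ i, v i * x (geomRep cs w (simpleRoot i)) := by
    intro v
    conv_lhs => rw [← sum_smul_simpleRoot v]
    simp
  have hδx : 0 < x (geomRep cs w δ) := by
    have hrad := hpsd.form_eq_zero hδδ
    rw [geomRep_apply_of_radical hrad, hx]
    refine Finset.sum_pos (fun d _ => ?_) ⟨1, by simp [hmemD]⟩
    rw [geomRep_apply_of_radical hrad, hp]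
    exact Finset.sum_pos (fun j _ => hδ j) Finset.univ_nonempty
  obtain ⟨i, hi⟩ : ∃ i, x (geomRep cs w (simpleRoot i)) ≠ 0 := by
    by_contra! hcon
    rw [hxsum] at hδx
    simp [hcon] at hδx
  have hcoord : ∀ a ∈ roots cs, a ∈ U → geomRep cs w⁻¹ a i = 0 := by
    intro a ha haU
    have h0 := hxsum (geomRep cs w⁻¹ a)
    rw [geomRep_apply_inv_self, hfix a ha haU] at h0
    have h1 : geomRep cs w⁻¹ a i * x (geomRep cs w (simpleRoot i)) = 0 := by
      rcases nonneg_or_nonpos_of_mem_roots (geomRep_mem_roots ha w⁻¹) with h | h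
      · exact (Finset.sum_eq_zero_iff_of_nonneg fun j _ => mul_nonneg (h j) (hw j)).mp h0.symm i
          (Finset.mem_univ i)
      · exact (Finset.sum_eq_zero_iff_of_nonpos fun j _ =>
          mul_nonpos_of_nonpos_of_nonneg (h j) (hw j)).mp h0.symm i (Finset.mem_univ i)
    exact (mul_eq_zero.mp h1).resolve_right hi
  exact ⟨w⁻¹, i, hcoord b hb hbU, hcoord c hc hcU⟩

theorem finite_roots_coord_eq_zero (hpsd : IsPosSemidef M) (hirr : IsIrreducible M) (i : B) :
    {b ∈ roots cs | b i = 0}.Finite := by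
  set U : Submodule ℝ (B → ℝ) := LinearMap.ker (LinearMap.proj i) with hU
  have hmemU : ∀ v : B → ℝ, v ∈ U ↔ v i = 0 := fun v => by simp [hU]
  have hfin := finite_setOf_geomRep_sub_mem cs hpsd U fun v hv hv0 => by
    refine lt_of_le_of_ne (hpsd v) fun h => ?_
    exact hpsd.ne_zero_of_isotropic hirr h.symm hv0 i ((hmemU v).mp hv)
  refine (hfin.biUnion (t := fun w => {b | form M b b = 1 ∧ geomRep cs w = reflection M b})
    fun w _ => ?_).subset ?_
  · obtain hemp | ⟨b₀, hb₀, hw₀⟩ :=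
      {b | form M b b = 1 ∧ geomRep cs w = reflection M b}.eq_empty_or_nonempty
    · rw [hemp]
      exact Set.finite_empty
    · refine (Set.toFinite {b₀, -b₀}).subset ?_
      rintro b ⟨hb, hw⟩
      have h1 : reflection M b₀ b = -b := by
        rw [← hw₀, hw, reflection_apply, hb]
        module
      rw [reflection_apply] at h1
      have h2 : b = form M b₀ b • b₀ := by
        have h3 : (2 : ℝ) • b = (2 : ℝ) • form M b₀ b • b₀ := by
          linear_combination (norm := module) h1
        exact smul_right_injective _ (two_ne_zero (α := ℝ)) h3
      have h4 : form M b₀ b * form M b₀ b = 1 := by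
        have h5 := congrArg (form M b) h2
        rwa [hb, map_smul, smul_eq_mul, form_comm M b b₀, eq_comm] at h5
      rcases mul_self_eq_one_iff.mp h4 with h | h <;> rw [h] at h2 <;> rw [h2] <;> simp
  · rintro b ⟨hb, hbi⟩
    obtain ⟨t, ht⟩ := exists_geomRep_eq_reflection hb
    refine Set.mem_iUnion₂.mpr ⟨t, fun v => ?_, form_self_of_mem_roots hb, ht⟩
    rw [ht, reflection_apply, sub_sub_cancel_left]
    exact U.neg_mem (U.smul_mem _ ((hmemU b).mpr hbi))

/-- Only finitely many inner products occur between roots of an affine Coxeter group. -/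
theorem finite_setOf_form_roots (hpsd : IsPosSemidef M) (hirr : IsIrreducible M)
    (hpd : ¬ IsPosDef M) : {r | ∃ b ∈ roots cs, ∃ c ∈ roots cs, r = form M b c}.Finite := by
  obtain ⟨δ, hδ, hδδ⟩ := hpsd.exists_pos_isotropic hirr hpd
  refine (((Set.finite_univ (α := B)).biUnion fun i _ =>
    Set.Finite.image2 (fun b c => form M b c) (finite_roots_coord_eq_zero (cs := cs) hpsd hirr i)
      (finite_roots_coord_eq_zero (cs := cs) hpsd hirr i)).union (Set.toFinite {1, -1})).subset ?_
  rintro r ⟨b, hb, c, hc, rfl⟩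
  have hle := hpsd.abs_form_le_one (form_self_of_mem_roots hb) (form_self_of_mem_roots hc)
  rcases hle.lt_or_eq with hlt | heq
  · obtain ⟨w, i, hbi, hci⟩ := exists_geomRep_coord_eq_zero hpsd hδ hδδ hirr.nonempty hb hc hlt
    refine Or.inl (Set.mem_iUnion₂.mpr ⟨i, Set.mem_univ i, geomRep cs w b,
      ⟨geomRep_mem_roots hb w, hbi⟩, geomRep cs w c, ⟨geomRep_mem_roots hc w, hci⟩, ?_⟩)
    exact form_geomRep cs w b c
  · exact Or.inr (by simpa using eq_or_eq_neg_of_abs_eq heq)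

variable (cs)

/-- The elements acting trivially modulo the radical of the form. -/
noncomputable def translationSubgroup : Subgroup W where
  carrier := {w | ∀ u v, form M u (geomRep cs w v) = form M u v}
  one_mem' := by simp
  mul_mem' := by
    intro a b ha hb u v
    rw [geomRep_mul_apply, ha, hb]
  inv_mem' := by
    intro a ha u v
    rw [← ha u (geomRep cs a⁻¹ v), geomRep_apply_inv_self]

theorem mem_translationSubgroup {w : W} :
    w ∈ translationSubgroup cs ↔ ∀ u v, form M u (geomRep cs w v) = form M u v := Iff.rfl

theorem translationSubgroup_comm {a b : W} (ha : a ∈ translationSubgroup cs)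
    (hb : b ∈ translationSubgroup cs) : a * b = b * a := by
  refine geomRep_injective cs (LinearMap.ext fun v => ?_)
  have hrad : ∀ c ∈ translationSubgroup cs, ∀ d, geomRep cs d (geomRep cs c v - v) =
      geomRep cs c v - v := fun c hc d =>
    geomRep_apply_of_radical (fun u => by rw [map_sub, hc u v, sub_self]) d
  have h1 := hrad a ha b
  have h2 := hrad b hb a
  rw [map_sub] at h1 h2
  rw [geomRep_mul_apply, geomRep_mul_apply]
  linear_combination (exp := 1) h2 - h1

theorem finiteIndex_translationSubgroup (hpsd : IsPosSemidef M) (hirr : IsIrreducible M)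
    (hpd : ¬ IsPosDef M) : (translationSubgroup cs).FiniteIndex := by
  have hE := finite_setOf_form_roots (cs := cs) hpsd hirr hpd
  set E := {r | ∃ b ∈ roots cs, ∃ c ∈ roots cs, r = form M b c}
  have : Finite E := hE
  let K : W → B → B → E := fun w i j => ⟨form M (simpleRoot i) (geomRep cs w (simpleRoot j)),
    simpleRoot i, simpleRoot_mem_roots i, _, geomRep_mem_roots (simpleRoot_mem_roots j) w, rfl⟩
  have hinj : Function.Injective fun q : W ⧸ translationSubgroup cs => K q.out := by
    intro q q' h
    rw [← QuotientGroup.out_eq' q, ← QuotientGroup.out_eq' q', QuotientGroup.eq,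
      mem_translationSubgroup]
    have h1 : ∀ j u, form M u (geomRep cs q.out (simpleRoot j)) =
        form M u (geomRep cs q'.out (simpleRoot j)) := by
      intro j u
      rw [form_eq_sum, form_eq_sum M u (geomRep cs q'.out _)]
      refine Finset.sum_congr rfl fun i _ => ?_
      congr 1
      exact congrArg Subtype.val (congrFun (congrFun h i) j)
    intro u v
    rw [← form_geomRep cs q.out, geomRep_mul_apply, geomRep_apply_inv_self,
      ← form_geomRep cs q.out u v, ← sum_smul_simpleRoot v]
    simp only [map_sum, map_smul, h1]
  have := Finite.of_injective _ hinj
  exact Subgroup.finiteIndex_of_finite_quotient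

end Affine

section FiniteIndex

variable {B : Type*} [Fintype B] (M : CoxeterMatrix B)

theorem isPosSemidef_of_card_le_two (hB : Fintype.card B ≤ 2) : IsPosSemidef M := by
  classical
  intro v
  rw [← Finset.card_univ] at hB
  unfold bilin
  interval_cases h : (Finset.univ : Finset B).card
  · rw [Finset.card_eq_zero.mp h]
    simp
  · obtain ⟨a, ha⟩ := Finset.card_eq_one.mp h
    rw [ha]
    simp [formEntry_self, mul_self_nonneg]
  · obtain ⟨a, b, hab, hu⟩ := Finset.card_eq_two.mp h
    rw [hu]
    simp only [Finset.sum_pair hab, formEntry_self, formEntry_comm M b a]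
    obtain ⟨h1, h2⟩ := abs_le.mp (abs_formEntry_le_one M a b)
    nlinarith [mul_nonneg (sub_nonneg.mpr h2) (sq_nonneg (v a - v b)),
      mul_nonneg (neg_le_iff_add_nonneg.mp h1) (sq_nonneg (v a + v b))]

/-- The transvection-like isometry scaling the isotropic vector `e` by `μ`, the isotropic vector
`f` by `μ⁻¹`, and fixing their orthogonal complement. -/
noncomputable def boost (e f : B → ℝ) (μ : ℝ) (v : B → ℝ) : B → ℝ :=
  v + ((μ - 1) * form M v f / form M e f) • e + ((μ⁻¹ - 1) * form M v e / form M e f) • f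

variable {M}

theorem boost_swap (e f : B → ℝ) (μ : ℝ) : boost M f e μ⁻¹ = boost M e f μ := by
  funext v
  rw [boost, boost, inv_inv, form_comm M f e]
  abel

theorem boost_one (e f v : B → ℝ) : boost M e f 1 v = v := by
  simp [boost]

theorem boost_boost {e f : B → ℝ} (he : form M e e = 0) (hf : form M f f = 0)
    (hef : form M e f ≠ 0) {μ ν : ℝ} (v : B → ℝ) :
    boost M e f μ (boost M e f ν v) = boost M e f (μ * ν) v := by
  simp only [boost, map_add, map_smul, LinearMap.add_apply, LinearMap.smul_apply, smul_eq_mul,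
    he, hf, form_comm M f e, mul_inv, mul_zero, add_zero, div_mul_cancel₀ _ hef]
  match_scalars <;> field_simp <;> ring

/-- A reflection whose conjugate of a boost commutes with this boost preserves the plane of the
boost. -/
theorem form_eq_zero_of_boost_commute {e f a : B → ℝ} (he : form M e e = 0)
    (hef : form M e f ≠ 0) {μ : ℝ} (hμ : 0 < μ) (hμ1 : μ ≠ 1)
    (ha : form M a a = 1) (haP : a ∉ Submodule.span ℝ {e, f})
    (hcomm : ∀ v, boost M e f μ (reflection M a (boost M e f μ (reflection M a v))) =
      reflection M a (boost M e f μ (reflection M a (boost M e f μ v)))) :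
    form M a e = 0 := by
  by_contra hp
  set κ := form M e f with hκ
  set p := form M a e with hpdef
  set q := form M a f with hqdef
  have hμ2 : μ - 1 ≠ 0 := sub_ne_zero.mpr hμ1
  have hea : form M e a = p := form_comm M e a
  have hfa : form M f a = q := form_comm M f a
  have hfe : form M f e = κ := form_comm M f e
  set X := (μ - 1) * (κ - 2 * p * q) / κ with hX
  set Y := (μ⁻¹ - 1) * (-2 * p ^ 2) / κ with hY
  set z := reflection M a (boost M e f μ (reflection M a e)) with hz
  have hz1 : z = (1 + X) • e + Y • f - (2 * p * X + 2 * q * Y) • a := by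
    simp only [hz, boost, reflection_apply, map_add, map_sub, map_smul, LinearMap.sub_apply,
      LinearMap.smul_apply, smul_eq_mul, he, ha, ← hκ, ← hpdef, ← hqdef, hX, hY]
    match_scalars <;> field_simp <;> ring
  have hbe : boost M e f μ e = μ • e := by
    simp only [boost, he, ← hκ, mul_zero, zero_div, zero_smul, add_zero, mul_div_cancel_right₀ _ hef]
    module
  have hbz : boost M e f μ z = μ • z := by
    have h1 := hcomm e
    rw [hbe] at h1
    rw [hz, h1]
    have hlin : ∀ v, boost M e f μ (μ • v) = μ • boost M e f μ v := fun v => by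
      simp only [boost, map_smul, LinearMap.smul_apply, smul_eq_mul]
      module
    rw [map_smul, hlin, map_smul]
  have hez : form M e z = 0 := by
    have h1 := congrArg (form M e) hbz
    simp only [boost, map_add, map_smul, smul_eq_mul, he, ← hκ, mul_zero, add_zero,
      form_comm M z e, div_mul_cancel₀ _ hef] at h1
    have h2 : (μ ^ 2 - 1) * form M e z = 0 := by
      field_simp at h1
      linear_combination -h1
    refine (mul_eq_zero.mp h2).resolve_left fun h3 => ?_
    have : (μ - 1) * (μ + 1) = 0 := by linear_combination h3
    rcases mul_eq_zero.mp this with h | h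
    · exact hμ2 h
    · linarith
  have hza : 2 * p * X + 2 * q * Y = 0 := by
    by_contra hne
    apply haP
    have h1 : ((μ - 1) * (2 * p * X + 2 * q * Y)) • a ∈ Submodule.span ℝ {e, f} := by
      rw [Submodule.mem_span_pair]
      refine ⟨(μ - 1) * (1 + X) - (μ - 1) * form M z f / κ,
        (μ - 1) * Y - (μ⁻¹ - 1) * form M z e / κ, ?_⟩
      have h2 : (μ - 1) • z = ((μ - 1) * form M z f / κ) • e +
          ((μ⁻¹ - 1) * form M z e / κ) • f := by
        rw [boost] at hbz
        linear_combination (norm := module) -hbz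
      have h3 := congrArg (fun v => (μ - 1) • v) hz1
      linear_combination (norm := module) h2 - h3
    have h2 := Submodule.smul_mem _ ((μ - 1) * (2 * p * X + 2 * q * Y))⁻¹ h1
    rwa [smul_smul, inv_mul_cancel₀ (mul_ne_zero hμ2 hne), one_smul] at h2
  rw [hz1, hza] at hez
  simp only [map_add, map_sub, map_smul, smul_eq_mul, he, ← hκ, mul_zero, zero_add, zero_mul,
    sub_zero] at hez
  have hY0 : Y = 0 := (mul_eq_zero.mp hez).resolve_right hef
  rw [hY, div_eq_zero_iff, or_iff_left hef, mul_eq_zero] at hY0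
  rcases hY0 with h | h
  · apply hμ1
    have := sub_eq_zero.mp h
    exact inv_eq_one.mp this
  · apply hp
    nlinarith

/-- The product of the reflections in two roots spanning an indefinite plane is a boost. -/
theorem exists_reflection_mul_reflection_eq_boost {a b : B → ℝ} (ha : form M a a = 1)
    (hb : form M b b = 1) (hab : 1 < |form M a b|) :
    ∃ e f μ, form M e e = 0 ∧ form M f f = 0 ∧ form M e f ≠ 0 ∧ 0 < μ ∧ μ ≠ 1 ∧
      ∀ v, (reflection M a * reflection M b) v = boost M e f μ v := by
  set c := form M a b with hc
  have hc1 : 0 < c ^ 2 - 1 := by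
    have := (one_lt_sq_iff_one_lt_abs c).mpr hab
    linarith
  obtain ⟨x, hx⟩ : ∃ x : ℝ, x ^ 2 + 2 * c * x + 1 = 0 :=
    ⟨-c + Real.sqrt (c ^ 2 - 1), by
      have := Real.sq_sqrt hc1.le
      linear_combination this⟩
  have hx0 : x ≠ 0 := by
    rintro rfl
    norm_num at hx
  have hx1 : x ^ 2 ≠ 1 := by
    intro h1
    have h2 : c * x = -1 := by linarith
    have h3 : c ^ 2 = 1 := by
      have : c ^ 2 * x ^ 2 = 1 := by rw [← mul_pow, h2]; norm_num
      rwa [h1, mul_one] at this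
    linarith
  have hcx : c = -(x + x⁻¹) / 2 := by
    field_simp
    linear_combination hx
  have hba : form M b a = c := form_comm M b a
  have hκ : form M (a + x • b) (a + x⁻¹ • b) = -(x - x⁻¹) ^ 2 / 2 := by
    simp only [map_add, map_smul, LinearMap.add_apply, LinearMap.smul_apply, smul_eq_mul, ha, hb,
      ← hc, hba, hcx]
    field_simp
    ring
  have hx2 : x ^ 2 - 1 ≠ 0 := sub_ne_zero.mpr hx1
  refine ⟨a + x • b, a + x⁻¹ • b, (x ^ 2)⁻¹, ?_, ?_, ?_, by positivity, ?_, fun v => ?_⟩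
  · simp only [map_add, map_smul, LinearMap.add_apply, LinearMap.smul_apply, smul_eq_mul, ha, hb,
      ← hc, hba, hcx]
    field_simp
    ring
  · simp only [map_add, map_smul, LinearMap.add_apply, LinearMap.smul_apply, smul_eq_mul, ha, hb,
      ← hc, hba, hcx]
    field_simp
    ring
  · rw [hκ]
    have h1 : x - x⁻¹ = (x ^ 2 - 1) / x := by field_simp
    have h2 : x - x⁻¹ ≠ 0 := h1 ▸ div_ne_zero hx2 hx0
    have := sq_pos_of_ne_zero h2
    linarith
  · rw [ne_eq, inv_eq_one]
    exact hx1
  · rw [boost, hκ, inv_inv, Module.End.mul_apply]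
    simp only [reflection_apply, map_add, map_sub, map_smul, smul_eq_mul, form_comm M v, 
      LinearMap.add_apply, LinearMap.smul_apply, ← hc, hcx]
    have h1 : x - x⁻¹ = (x ^ 2 - 1) / x := by field_simp
    rw [h1]
    match_scalars <;> field_simp <;> ring

theorem pow_apply_of_eq_boost {e f : B → ℝ} (he : form M e e = 0) (hf : form M f f = 0)
    (hef : form M e f ≠ 0) {μ : ℝ} {r : Module.End ℝ (B → ℝ)}
    (hr : ∀ v, r v = boost M e f μ v) (n : ℕ) (v : B → ℝ) :
    (r ^ n) v = boost M e f (μ ^ n) v := by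
  induction n with
  | zero => simp [boost_one]
  | succ n ih => rw [pow_succ', Module.End.mul_apply, ih, hr, boost_boost he hf hef, pow_succ']

/-- The square norm is controlled by the inner products with the simple roots. -/
theorem exists_abs_form_self_le [DecidableEq B] (M : CoxeterMatrix B) : ∃ C, 0 ≤ C ∧
    ∀ (v : B → ℝ) (ε : ℝ), (∀ i, form M (simpleRoot i) v ^ 2 ≤ ε) → |form M v v| ≤ C * ε := by
  let G : (B → ℝ) →ₗ[ℝ] (B → ℝ) := LinearMap.pi fun i => form M (simpleRoot i)
  obtain ⟨R₀, hR₀⟩ := G.rangeRestrict.exists_rightInverse_of_surjective G.range_rangeRestrict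
  obtain ⟨R, hR⟩ := R₀.exists_extend
  have hGR : ∀ v, G (R (G v)) = G v := fun v => by
    have h1 : R (G v) = R₀ (G.rangeRestrict v) := by
      rw [← hR]
      rfl
    rw [h1]
    exact congrArg Subtype.val (LinearMap.congr_fun hR₀ (G.rangeRestrict v))
  refine ⟨∑ i, ∑ j, |R (simpleRoot j) i|,
    Finset.sum_nonneg fun i _ => Finset.sum_nonneg fun j _ => abs_nonneg _, fun v ε hε => ?_⟩
  have h1 : form M v v = ∑ i, ∑ j, G v j * R (simpleRoot j) i * G v i := by
    have h2 : form M v (R (G v)) = form M v v := by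
      rw [form_eq_sum, form_eq_sum M v v]
      exact Finset.sum_congr rfl fun i _ => congrArg (v i * ·) (congrFun (hGR v) i)
    rw [← h2, form_comm, form_eq_sum]
    refine Finset.sum_congr rfl fun i _ => ?_
    conv_lhs => rw [← sum_smul_simpleRoot (G v)]
    simp [Finset.sum_apply, Finset.sum_mul, G]
  rw [h1, Finset.sum_mul]
  refine (Finset.abs_sum_le_sum_abs _ _).trans (Finset.sum_le_sum fun i _ => ?_)
  rw [Finset.sum_mul]
  refine (Finset.abs_sum_le_sum_abs _ _).trans (Finset.sum_le_sum fun j _ => ?_)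
  have h3 : |G v j| * |G v i| ≤ ε := by
    have hi : |G v i| ^ 2 ≤ ε := by rw [sq_abs]; exact hε i
    have hj : |G v j| ^ 2 ≤ ε := by rw [sq_abs]; exact hε j
    nlinarith [sq_nonneg (|G v i| - |G v j|)]
  rw [abs_mul, abs_mul]
  nlinarith [mul_le_mul_of_nonneg_left h3 (abs_nonneg (R (simpleRoot j) i))]

/-- If all inner products between roots are at most one in absolute value, the form is
semidefinite. -/
theorem isPosSemidef_of_abs_form_le_one {W : Type*} [Group W] [DecidableEq B] (cs : CoxeterSystem M W)
    (h : ∀ i j w, |form M (simpleRoot i) (geomRep cs w (simpleRoot j))| ≤ 1) :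
    IsPosSemidef M := by
  by_contra hpsd
  simp only [IsPosSemidef, not_forall, not_le] at hpsd
  obtain ⟨v₀, hv₀⟩ := hpsd
  rw [← form_apply] at hv₀
  obtain ⟨C, hC0, hC⟩ := exists_abs_form_self_le M
  set K : Set (B → ℝ) := {v | ∀ w i, |form M (simpleRoot i) (geomRep cs w v)| ≤ 1} with hK
  set S := (fun v => form M v v) '' K with hS
  have hbdd : BddBelow S := by
    refine ⟨-(C * 1), ?_⟩
    rintro _ ⟨v, hv, rfl⟩
    refine (abs_le.mp (hC v 1 fun i => ?_)).1
    have := hv 1 i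
    rw [map_one, Module.End.one_apply] at this
    exact (sq_le_one_iff_abs_le_one _).mpr this
  have hmem : ∃ v ∈ K, form M v v < 0 := by
    have hc : 0 < 1 + ∑ j, |v₀ j| := by
      have := Finset.sum_nonneg fun j (_ : j ∈ Finset.univ) => abs_nonneg (v₀ j)
      linarith
    refine ⟨(1 + ∑ j, |v₀ j|)⁻¹ • v₀, fun w i => ?_, ?_⟩
    · rw [map_smul, map_smul, smul_eq_mul, abs_mul, abs_of_pos (inv_pos.mpr hc),
        inv_mul_le_one₀ hc]
      have h1 : |form M (simpleRoot i) (geomRep cs w v₀)| ≤ ∑ j, |v₀ j| := by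
        conv_lhs => rw [← sum_smul_simpleRoot v₀]
        simp only [map_sum, map_smul, smul_eq_mul]
        refine (Finset.abs_sum_le_sum_abs _ _).trans (Finset.sum_le_sum fun j _ => ?_)
        rw [abs_mul]
        exact mul_le_of_le_one_right (abs_nonneg _) (h i j w)
      linarith
    · simp only [map_smul, LinearMap.smul_apply, smul_eq_mul]
      exact mul_neg_of_pos_of_neg (inv_pos.mpr hc)
        (mul_neg_of_pos_of_neg (inv_pos.mpr hc) hv₀)
  obtain ⟨v₁, hv₁K, hv₁⟩ := hmem
  set m := sInf S with hm
  have hm0 : m < 0 := (csInf_le hbdd ⟨v₁, hv₁K, rfl⟩).trans_lt hv₁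
  set ε := -m / (C + 1) with hε
  have hε0 : 0 < ε := div_pos (by linarith) (by linarith)
  have hεC : ε * (C + 1) = -m := div_mul_cancel₀ _ (by linarith)
  obtain ⟨_, ⟨v, hvK, rfl⟩, hv⟩ := exists_lt_of_csInf_lt (s := S) ⟨_, v₁, hv₁K, rfl⟩
    (show sInf S < m + ε by linarith)
  have hsmall : ∀ i, form M (simpleRoot i) v ^ 2 ≤ ε := by
    intro i
    set y := form M (simpleRoot i) v with hy
    have hmid : v - y • simpleRoot i ∈ K := by
      intro w j
      have h1 := hvK w j
      have h2 := hvK (w * cs.simple i) j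
      have h3 : form M (simpleRoot j) (geomRep cs w (v - y • simpleRoot i)) =
          (form M (simpleRoot j) (geomRep cs w v) +
            form M (simpleRoot j) (geomRep cs (w * cs.simple i) v)) / 2 := by
        rw [geomRep_mul_apply, geomRep_simple, reflection_apply]
        simp only [map_sub, map_smul, smul_eq_mul, ← hy]
        ring
      rw [h3]
      rw [abs_le] at *
      constructor <;> linarith
    have h1 : m ≤ form M (v - y • simpleRoot i) (v - y • simpleRoot i) :=
      csInf_le hbdd ⟨_, hmid, rfl⟩
    simp only [map_sub, map_smul, LinearMap.sub_apply, LinearMap.smul_apply, smul_eq_mul,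
      form_simpleRoot_self, form_comm M v (simpleRoot i), ← hy] at h1
    simp only at hv
    linarith
  have h1 := (abs_le.mp (hC v ε hsmall)).1
  simp only at hv
  linarith

/-- An irreducible Coxeter group that is virtually abelian has a semidefinite form. -/
theorem isPosSemidef_of_abelian_finiteIndex {W : Type*} [Group W] [DecidableEq B] (cs : CoxeterSystem M W)
    (hirr : IsIrreducible M) {A : Subgroup W}
    (hA : A.FiniteIndex) (hcomm : ∀ a ∈ A, ∀ b ∈ A, a * b = b * a) : IsPosSemidef M := by
  by_contra hpsd
  have hbig : ∃ i j w, 1 < |form M (simpleRoot i) (geomRep cs w (simpleRoot j))| := by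
    by_contra! hcon
    exact hpsd (isPosSemidef_of_abs_form_le_one cs hcon)
  obtain ⟨i, j, w, hij⟩ := hbig
  obtain ⟨e, f, μ, he, hf, hef, hμ, hμ1, hr⟩ := exists_reflection_mul_reflection_eq_boost
    (form_simpleRoot_self M i) (by rw [form_geomRep, form_simpleRoot_self]) hij
  set N := A.normalCore.index with hN
  have hN0 : N ≠ 0 := Subgroup.FiniteIndex.index_ne_zero
  set g := (cs.simple i * (w * cs.simple j * w⁻¹)) ^ N with hg
  have hgA : g ∈ A.normalCore := Subgroup.pow_index_mem _ _
  have hgv : ∀ v, geomRep cs g v = boost M e f (μ ^ N) v := by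
    intro v
    rw [hg, map_pow, map_mul, geomRep_simple, geomRep_conj_simple]
    exact pow_apply_of_eq_boost he hf hef hr N v
  have hμN : 0 < μ ^ N := pow_pos hμ N
  have hμN1 : μ ^ N ≠ 1 := fun h => hμ1 ((pow_eq_one_iff_of_nonneg hμ.le hN0).mp h)
  set P := Submodule.span ℝ {e, f} with hP
  have hk : ∀ k, ∀ v, boost M e f (μ ^ N) (reflection M (simpleRoot k)
      (boost M e f (μ ^ N) (reflection M (simpleRoot k) v))) =
      reflection M (simpleRoot k) (boost M e f (μ ^ N) (reflection M (simpleRoot k)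
        (boost M e f (μ ^ N) v))) := by
    intro k v
    have hmem := Subgroup.normalCore_normal (H := A) |>.conj_mem g hgA (cs.simple k)
    have h1 := hcomm g (A.normalCore_le hgA) _ (A.normalCore_le hmem)
    have h2 := congrArg (fun x => geomRep cs x v) h1
    simpa only [cs.inv_simple, geomRep_mul_apply, geomRep_simple, hgv] using h2
  have hdich : ∀ k, simpleRoot k ∉ P →
      form M (simpleRoot k) e = 0 ∧ form M (simpleRoot k) f = 0 := by
    intro k hkP
    refine ⟨form_eq_zero_of_boost_commute he hef hμN hμN1 (form_simpleRoot_self M k) hkP (hk k),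
      form_eq_zero_of_boost_commute (e := f) (f := e) (μ := (μ ^ N)⁻¹) hf
      (by rwa [form_comm]) (inv_pos.mpr hμN) (by rwa [ne_eq, inv_eq_one])
      (form_simpleRoot_self M k) (by rwa [Set.pair_comm]) ?_⟩
    simpa only [boost_swap] using hk k
  have horth : ∀ k, simpleRoot k ∉ P → ∀ v ∈ P, form M (simpleRoot k) v = 0 := by
    intro k hkP v hv
    obtain ⟨x, y, rfl⟩ := Submodule.mem_span_pair.mp hv
    simp [(hdich k hkP).1, (hdich k hkP).2]
  have hex : ∃ k, simpleRoot k ∈ P := by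
    by_contra! hcon
    apply hef
    rw [form_eq_sum]
    simp [(hdich _ (hcon _)).2]
  obtain ⟨k₀, hk₀⟩ := hex
  have hall : ∀ k, simpleRoot k ∈ P := by
    refine hirr.forall_of_exists (P := fun k => simpleRoot k ∈ P) (fun k l _ hne hkP => ?_) hk₀
    by_contra hlP
    apply hne
    rw [formEntry_comm, ← form_simpleRoot, horth l hlP _ hkP]
  have htop : P = ⊤ := by
    rw [eq_top_iff]
    intro v _
    rw [← sum_smul_simpleRoot v]
    exact P.sum_mem fun k _ => P.smul_mem _ (hall k)
  refine hpsd (isPosSemidef_of_card_le_two M ?_)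
  rw [← Module.finrank_fintype_fun_eq_card ℝ (η := B), ← finrank_top ℝ (B → ℝ), ← htop, hP]
  have h1 := finrank_span_finset_le_card (R := ℝ) {e, f}
  rw [Finset.coe_pair, Set.finrank] at h1
  exact h1.trans Finset.card_le_two

end FiniteIndex

/-- An irreducible, infinite Coxeter group is affine (its standard
bilinear form is positive semidefinite but not positive definite) if and only if it
contains an abelian subgroup of finite index. -/
theorem affine_iff_abelian_finiteIndex_subgroup
    {B W : Type*} [Fintype B] [Group W] {M : CoxeterMatrix B} (cs : CoxeterSystem M W)
    (hirr : IsIrreducible M) (hinf : Infinite W) :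
    (IsPosSemidef M ∧ ¬ IsPosDef M) ↔
      ∃ A : Subgroup W, A.FiniteIndex ∧ ∀ a ∈ A, ∀ b ∈ A, a * b = b * a := by
  classical
  constructor
  · rintro ⟨hpsd, hpd⟩
    exact ⟨translationSubgroup cs, finiteIndex_translationSubgroup cs hpsd hirr hpd,
      fun a ha b hb => translationSubgroup_comm cs ha hb⟩
  · rintro ⟨A, hA, hcomm⟩
    refine ⟨isPosSemidef_of_abelian_finiteIndex cs hirr hA hcomm, fun hpd => ?_⟩
    exact not_finite_iff_infinite.mpr hinf (finite_of_isPosDef cs hpd)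

end CoxeterPaper
end

section
/- Let W be a group generated by a set S of involutions, with length function l = l_S. Then (W,S) is a Coxeter system if and only if W satisfies any one of the following three conditions: (D) Deletion Condition: if w = s_1⋯s_d with d > l(w), then there are indices i < j such that w = s_1⋯ŝ_i⋯ŝ_j⋯s_d (the hats indicating deleted letters); (E) Exchange Condition: given w ∈ W, s ∈ S, and any reduced decomposition w = s_1⋯s_d of w, either l(sw) = d + 1 or else there is an index i such that w = s s_1⋯ŝ_i⋯s_d; (F) Folding Condition: given w ∈ W and s, t ∈ S such that l(sw) = l(w) + 1 and l(wt) = l(w) + 1, either l(swt) = l(w) + 2 or else sw = wt. -/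
namespace CoxeterPaper

/-- The length `l_S(w)` of `w` with respect to a generating set `S`: the smallest `d`
such that `w` is a product of `d` elements of `S`. -/
noncomputable def lengthWrt {W : Type*} [Group W] (S : Set W) (w : W) : ℕ :=
  sInf {d | ∃ l : List W, (∀ x ∈ l, x ∈ S) ∧ l.length = d ∧ l.prod = w}

/-- **(D) Deletion Condition.** If `w = s_1 ⋯ s_d` with `d > l(w)`, then there are
indices `i < j` such that `w = s_1 ⋯ ŝ_i ⋯ ŝ_j ⋯ s_d`. -/
def DeletionCondition {W : Type*} [Group W] (S : Set W) : Prop :=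
  ∀ l : List W, (∀ x ∈ l, x ∈ S) → lengthWrt S l.prod < l.length →
    ∃ i j, i < j ∧ j < l.length ∧ l.prod = ((l.eraseIdx j).eraseIdx i).prod

/-- **(E) Exchange Condition.** Given `w ∈ W`, `s ∈ S` and any reduced decomposition
`w = s_1 ⋯ s_d` of `w`, either `l(sw) = d + 1` or else there is an index `i` such
that `w = s s_1 ⋯ ŝ_i ⋯ s_d`. -/
def ExchangeCondition {W : Type*} [Group W] (S : Set W) : Prop :=
  ∀ l : List W, (∀ x ∈ l, x ∈ S) → lengthWrt S l.prod = l.length →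
    ∀ s ∈ S, lengthWrt S (s * l.prod) = l.length + 1 ∨
      ∃ i < l.length, l.prod = s * (l.eraseIdx i).prod

/-- **(F) Folding Condition.** Given `w ∈ W` and `s, t ∈ S` such that
`l(sw) = l(w) + 1` and `l(wt) = l(w) + 1`, either `l(swt) = l(w) + 2` or `sw = wt`. -/
def FoldingCondition {W : Type*} [Group W] (S : Set W) : Prop :=
  ∀ w : W, ∀ s ∈ S, ∀ t ∈ S,
    lengthWrt S (s * w) = lengthWrt S w + 1 →
    lengthWrt S (w * t) = lengthWrt S w + 1 →
    lengthWrt S (s * w * t) = lengthWrt S w + 2 ∨ s * w = w * t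

/-- `(W, S)` is a Coxeter system: there is a Coxeter matrix `M` indexed by `S` and a
Coxeter system structure on `W` for `M` whose simple reflections are exactly the
elements of `S` (i.e. `W` has the presentation `⟨S ∣ (st)^{m_{st}} = 1⟩`). -/
def IsCoxeterSystemOn {W : Type*} [Group W] (S : Set W) : Prop :=
  ∃ (M : CoxeterMatrix S) (cs : CoxeterSystem M W), ∀ s : S, cs.simple s = (s : W)

/-- A list of elements of `S`. -/
def IsWord {W : Type*} (S : Set W) (l : List W) : Prop := ∀ x ∈ l, x ∈ S

theorem IsWord.eraseIdx {W : Type*} {S : Set W} {l : List W} (hl : IsWord S l) (i : ℕ) :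
    IsWord S (l.eraseIdx i) := fun x hx => hl x (List.mem_of_mem_eraseIdx hx)

theorem IsWord.cons {W : Type*} {S : Set W} {l : List W} {s : W} (hs : s ∈ S)
    (hl : IsWord S l) : IsWord S (s :: l) := List.forall_mem_cons.2 ⟨hs, hl⟩

theorem IsWord.append {W : Type*} {S : Set W} {l l' : List W} (hl : IsWord S l)
    (hl' : IsWord S l') : IsWord S (l ++ l') := List.forall_mem_append.2 ⟨hl, hl'⟩

section Length

variable {W : Type*} [Group W] {S : Set W}

theorem lengthWrt_prod_le {l : List W} (hl : IsWord S l) : lengthWrt S l.prod ≤ l.length :=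
  Nat.sInf_le ⟨l, hl, rfl, rfl⟩

theorem exists_reduced_word (hsq : ∀ s ∈ S, s * s = 1) (hgen : Subgroup.closure S = ⊤) (w : W) :
    ∃ l : List W, IsWord S l ∧ l.length = lengthWrt S w ∧ l.prod = w := by
  have hne : {d | ∃ l : List W, (∀ x ∈ l, x ∈ S) ∧ l.length = d ∧ l.prod = w}.Nonempty := by
    have hw : w ∈ (Subgroup.closure S).toSubmonoid := hgen ▸ Subgroup.mem_top w
    rw [Subgroup.closure_toSubmonoid] at hw
    obtain ⟨l, hl, rfl⟩ := Submonoid.exists_list_of_mem_closure hw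
    refine ⟨l.length, l, fun x hx => ?_, rfl, rfl⟩
    rcases hl x hx with h | h
    · exact h
    · rwa [← inv_inv x, inv_eq_of_mul_eq_one_right (hsq _ h)]
  exact Nat.sInf_mem hne

theorem lengthWrt_one : lengthWrt S (1 : W) = 0 :=
  Nat.le_zero.1 (lengthWrt_prod_le (S := S) (l := []) (by simp [IsWord]))

theorem lengthWrt_mul_le (hsq : ∀ s ∈ S, s * s = 1) (hgen : Subgroup.closure S = ⊤) (v w : W) :
    lengthWrt S (v * w) ≤ lengthWrt S v + lengthWrt S w := by
  obtain ⟨l, hl, hlen, rfl⟩ := exists_reduced_word hsq hgen v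
  obtain ⟨l', hl', hlen', rfl⟩ := exists_reduced_word hsq hgen w
  rw [← hlen, ← hlen', ← List.prod_append, ← List.length_append]
  exact lengthWrt_prod_le (hl.append hl')

theorem lengthWrt_of_mem_le {s : W} (hs : s ∈ S) : lengthWrt S s ≤ 1 := by
  simpa using lengthWrt_prod_le (S := S) (l := [s]) (by simpa [IsWord] using hs)

theorem lengthWrt_of_mem (hsq : ∀ s ∈ S, s * s = 1) (hne : ∀ s ∈ S, s ≠ 1)
    (hgen : Subgroup.closure S = ⊤) {s : W} (hs : s ∈ S) : lengthWrt S s = 1 := by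
  refine le_antisymm (lengthWrt_of_mem_le hs) (Nat.one_le_iff_ne_zero.2 fun h => hne s hs ?_)
  obtain ⟨l, -, hlen, rfl⟩ := exists_reduced_word hsq hgen s
  rw [List.length_eq_zero_iff.1 (hlen.trans h), List.prod_nil]

theorem reduced_left_of_append (hsq : ∀ s ∈ S, s * s = 1) (hgen : Subgroup.closure S = ⊤)
    {l l' : List W} (hl : IsWord S l) (hl' : IsWord S l')
    (h : lengthWrt S (l ++ l').prod = (l ++ l').length) : lengthWrt S l.prod = l.length := by
  have h₁ := lengthWrt_prod_le hl
  have h₂ := lengthWrt_prod_le hl'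
  have h₃ := lengthWrt_mul_le hsq hgen l.prod l'.prod
  simp only [List.prod_append, List.length_append] at h
  omega

theorem reduced_right_of_append (hsq : ∀ s ∈ S, s * s = 1) (hgen : Subgroup.closure S = ⊤)
    {l l' : List W} (hl : IsWord S l) (hl' : IsWord S l')
    (h : lengthWrt S (l ++ l').prod = (l ++ l').length) : lengthWrt S l'.prod = l'.length := by
  have h₁ := lengthWrt_prod_le hl
  have h₂ := lengthWrt_prod_le hl'
  have h₃ := lengthWrt_mul_le hsq hgen l.prod l'.prod
  simp only [List.prod_append, List.length_append] at h
  omega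

end Length

section ReflectionAction

variable {W : Type*} [Group W]

open scoped Classical in
/-- The action of a letter `s` on `W × ZMod 2`: conjugate the first coordinate by `s`, and flip the
second one exactly when the first is `s`. -/
noncomputable def reflStep (s : W) : Function.End (W × ZMod 2) :=
  fun p => (s * p.1 * s, p.2 + if p.1 = s then 1 else 0)

open scoped Classical in
theorem reflStep_mul_pow {s t : W} (hs : s * s = 1) (ht : t * t = 1) (n : ℕ) (p : W × ZMod 2) :
    ((reflStep s * reflStep t) ^ n) p = ((s * t) ^ n * p.1 * ((s * t) ^ n)⁻¹,
      p.2 + ∑ j ∈ Finset.range (2 * n), if p.1 = ((s * t) ^ j)⁻¹ * t then 1 else 0) := by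
  have hs' : s⁻¹ = s := inv_eq_of_mul_eq_one_right hs
  have ht' : t⁻¹ = t := inv_eq_of_mul_eq_one_right ht
  have hconj (k : ℕ) : t * (s * t) ^ k * t = ((s * t) ^ k)⁻¹ := by
    have := conj_pow (i := k) (a := t) (b := s * t)
    rw [ht'] at this
    rw [← this, ← inv_pow]
    congr 1
    rw [mul_inv_rev, hs', ht', ← mul_assoc, mul_assoc, ht, mul_one]
  have hconj' (k : ℕ) : t * (s * t) ^ k = ((s * t) ^ k)⁻¹ * t := by
    rw [← hconj, mul_assoc _ t t, ht, mul_one]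
  induction n with
  | zero => 
    refine Prod.ext (Eq.trans ?_ (by simp : p.1 = _)) (Eq.trans ?_ (by simp : p.2 = _)) <;> rfl
  | succ n ih =>
    have h₁ : ((s * t) ^ n * p.1 * ((s * t) ^ n)⁻¹ = t) ↔ p.1 = ((s * t) ^ (2 * n))⁻¹ * t := by
      rw [mul_inv_eq_iff_eq_mul, hconj', ← eq_inv_mul_iff_mul_eq, two_mul, pow_add, mul_inv_rev,
        mul_assoc]
    have h₂ : (t * ((s * t) ^ n * p.1 * ((s * t) ^ n)⁻¹) * t = s) ↔
        p.1 = ((s * t) ^ (2 * n + 1))⁻¹ * t := by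
      rw [← eq_mul_inv_iff_mul_eq, ← eq_inv_mul_iff_mul_eq, mul_inv_eq_iff_eq_mul,
        ← eq_inv_mul_iff_mul_eq, ht', show 2 * n + 1 = n + 1 + n by omega, pow_add, pow_succ,
        show t * (s * t) * (s * t) ^ n = (s * t)⁻¹ * (((s * t) ^ n)⁻¹ * t) by
          rw [← hconj' n, mul_inv_rev, ht', hs']; simp only [mul_assoc]]
      simp only [mul_assoc, mul_inv_rev]
    rw [pow_succ']
    change (reflStep s) ((reflStep t) (((reflStep s * reflStep t) ^ n) p)) = _
    rw [ih]
    simp only [reflStep, h₁, h₂]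
    rw [show 2 * (n + 1) = 2 * n + 1 + 1 by ring, Finset.sum_range_succ, Finset.sum_range_succ,
      pow_succ' _ n, mul_inv_rev, mul_inv_rev, hs', ht']
    simp only [mul_assoc, add_assoc]

theorem reflStep_mul_pow_eq_one {s t : W} (hs : s * s = 1) (ht : t * t = 1) {m : ℕ}
    (hm : (s * t) ^ m = 1) : (reflStep s * reflStep t) ^ m = 1 := by
  funext p
  refine (reflStep_mul_pow hs ht m p).trans (Prod.ext ?_ ?_)
  · change _ = p.1
    simp [hm]
  · change _ = p.2
    have hper (j : ℕ) : (s * t) ^ (m + j) = (s * t) ^ j := by rw [pow_add, hm, one_mul]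
    rw [two_mul, Finset.sum_range_add]
    refine (congrArg (p.2 + ·) ?_).trans (add_zero _)
    refine (congrArg (_ + ·) (Finset.sum_congr rfl fun j _ => ?_)).trans
      (CharTwo.add_self_eq_zero _)
    rw [hper]

/-- In a group acting on `W × ZMod 2` through `reflStep`, the parity attached to a word and an
element `t` detects whether multiplying by `t` deletes a letter of the word. -/
theorem mul_prod_eq_eraseIdx_of_action {S : Set W} (hsq : ∀ s ∈ S, s * s = 1)
    (φ : W →* Function.End (W × ZMod 2)) (hφ : ∀ s ∈ S, φ s = reflStep s)
    (l : List W) (hl : IsWord S l) (t : W) (e : ZMod 2) (h : (φ l.prod⁻¹ (t, e)).2 ≠ e) :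
    ∃ i < l.length, t * l.prod = (l.eraseIdx i).prod := by
  induction l generalizing t e with
  | nil =>
    rw [List.prod_nil, inv_one, map_one] at h
    exact absurd rfl h
  | cons s l ih =>
    obtain ⟨hs, hl⟩ := List.forall_mem_cons.1 hl
    rw [List.prod_cons, mul_inv_rev, inv_eq_of_mul_eq_one_right (hsq s hs), map_mul, hφ s hs] at h
    by_cases hts : t = s
    · exact ⟨0, by simp, by simp [hts, ← mul_assoc, hsq s hs]⟩
    · obtain ⟨i, hi, hprod⟩ := ih hl (s * t * s) e (by
        intro h'
        apply h
        change (φ l.prod⁻¹ (reflStep s (t, e))).2 = e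
        simpa [reflStep, hts] using h')
      refine ⟨i + 1, by simpa using hi, ?_⟩
      rw [List.eraseIdx_cons_succ, List.prod_cons, List.prod_cons, ← hprod]
      simp only [← mul_assoc, hsq s hs, one_mul]

theorem action_snd_add_one {S : Set W} (φ : W →* Function.End (W × ZMod 2))
    (hφ : ∀ s ∈ S, φ s = reflStep s) (l : List W) (hl : IsWord S l) (t : W) (e : ZMod 2) :
    (φ l.prod (t, e + 1)) = ((φ l.prod (t, e)).1, (φ l.prod (t, e)).2 + 1) := by
  induction l with
  | nil =>
    rw [List.prod_nil, map_one]
    rfl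
  | cons s l ih =>
    obtain ⟨hs, hl⟩ := List.forall_mem_cons.1 hl
    rw [List.prod_cons, map_mul, hφ s hs]
    change reflStep s (φ l.prod (t, e + 1)) = ((reflStep s (φ l.prod (t, e))).1,
      (reflStep s (φ l.prod (t, e))).2 + 1)
    rw [ih hl]
    simp only [reflStep, add_right_comm]

end ReflectionAction

section Implications

variable {W : Type*} [Group W] {S : Set W}

theorem IsCoxeterSystemOn.exchangeCondition (hsq : ∀ s ∈ S, s * s = 1)
    (hgen : Subgroup.closure S = ⊤) (h : IsCoxeterSystemOn S) : ExchangeCondition S := by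
  obtain ⟨M, cs, hcs⟩ := h
  have hlift : M.IsLiftable fun s : S => reflStep (s : W) := fun s t =>
    reflStep_mul_pow_eq_one (hsq s s.2) (hsq t t.2) (by
      rw [← hcs s, ← hcs t]
      exact cs.simple_mul_simple_pow s t)
  obtain ⟨φ, hφ⟩ : ∃ φ : W →* Function.End (W × ZMod 2), ∀ s ∈ S, φ s = reflStep s :=
    ⟨cs.lift ⟨_, hlift⟩, fun s hs => by
      simpa only [hcs] using cs.lift_apply_simple hlift ⟨s, hs⟩⟩
  intro l hl hred s hs
  by_cases h : (φ l.prod⁻¹ (s, 0)).2 = 0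
  · left
    obtain ⟨l', hl', hlen', hprod'⟩ := exists_reduced_word hsq hgen (s * l.prod)
    obtain ⟨k, hk, -, hkprod⟩ := exists_reduced_word hsq hgen l.prod⁻¹
    have key : (φ l'.prod⁻¹ (s, 0)).2 ≠ 0 := by
      rw [hprod', mul_inv_rev, inv_eq_of_mul_eq_one_right (hsq s hs), map_mul, hφ s hs]
      change (φ l.prod⁻¹ (reflStep s (s, 0))).2 ≠ 0
      have : reflStep s (s, 0) = (s, 0 + 1) := by simp [reflStep, hsq s hs]
      rw [this, ← hkprod, action_snd_add_one φ hφ k hk, hkprod, h]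
      simp
    obtain ⟨i, hi, hdel⟩ := mul_prod_eq_eraseIdx_of_action hsq φ hφ l' hl' s 0 key
    rw [hprod', ← mul_assoc, hsq s hs, one_mul] at hdel
    have h₁ := lengthWrt_prod_le (hl'.eraseIdx i)
    rw [← hdel, List.length_eraseIdx_of_lt hi, hred] at h₁
    have h₂ := lengthWrt_prod_le (IsWord.cons hs hl)
    rw [List.prod_cons, List.length_cons] at h₂
    omega
  · right
    obtain ⟨i, hi, hdel⟩ := mul_prod_eq_eraseIdx_of_action hsq φ hφ l hl s 0 h
    exact ⟨i, hi, by rw [← hdel, ← mul_assoc, hsq s hs, one_mul]⟩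

theorem ExchangeCondition.deletionCondition (hsq : ∀ s ∈ S, s * s = 1)
    (h : ExchangeCondition S) : DeletionCondition S := by
  intro l hl hlt
  induction l with
  | nil => simp at hlt
  | cons s l ih =>
    obtain ⟨hs, hl⟩ := List.forall_mem_cons.1 hl
    rcases (lengthWrt_prod_le hl).lt_or_eq with hlt' | hred
    · obtain ⟨i, j, hij, hj, hprod⟩ := ih hl hlt'
      exact ⟨i + 1, j + 1, by omega, by simpa using hj, by simp [hprod]⟩
    · rcases h l hl hred s hs with h | ⟨i, hi, hprod⟩
      · rw [List.prod_cons, List.length_cons] at hlt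
        omega
      · exact ⟨0, i + 1, by omega, by simpa using hi, by
          simp [hprod, ← mul_assoc, hsq s hs]⟩

theorem DeletionCondition.foldingCondition (hsq : ∀ s ∈ S, s * s = 1)
    (hgen : Subgroup.closure S = ⊤) (h : DeletionCondition S) : FoldingCondition S := by
  intro w s hs t ht hsw hwt
  obtain ⟨l, hl, hlen, rfl⟩ := exists_reduced_word hsq hgen w
  have hlt : IsWord S (l ++ [t]) := hl.append (by simpa [IsWord] using ht)
  have hword : IsWord S (s :: (l ++ [t])) := hlt.cons hs
  have hle := lengthWrt_prod_le hword
  have hprod : (s :: (l ++ [t])).prod = s * l.prod * t := by simp [mul_assoc]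
  have hlength : (s :: (l ++ [t])).length = l.length + 2 := by simp
  rw [hprod, hlength] at hle
  rw [← hlen] at hsw hwt ⊢
  refine or_iff_not_imp_left.2 fun hne => ?_
  obtain ⟨i, j, hij, hj, hdel⟩ := h _ hword (by rw [hprod, hlength]; omega)
  rw [hlength] at hj
  obtain ⟨j, rfl⟩ : ∃ k, j = k + 1 := ⟨j - 1, by omega⟩
  rw [List.eraseIdx_cons_succ] at hdel
  have hlenj : ((l ++ [t]).eraseIdx j).length = l.length := by
    rw [List.length_eraseIdx_of_lt (by simp; omega)]
    simp
  rcases i with _ | i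
  · rw [List.eraseIdx_zero, List.tail_cons, hprod] at hdel
    rcases lt_or_ge j l.length with hjl | hjl
    · rw [List.eraseIdx_append_of_lt_length hjl, List.prod_append, List.prod_singleton,
        mul_left_inj] at hdel
      have := lengthWrt_prod_le (hl.eraseIdx j)
      rw [← hdel, List.length_eraseIdx_of_lt hjl] at this
      omega
    · obtain rfl : j = l.length := by omega
      rw [List.eraseIdx_append_of_length_le le_rfl] at hdel
      simp only [Nat.sub_self, List.eraseIdx_zero, List.tail_cons, List.append_nil] at hdel
      rw [← mul_right_cancel_iff (a := t), hdel]
      rw [mul_assoc, hsq t ht, mul_one]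
  · rw [List.eraseIdx_cons_succ, List.prod_cons, List.prod_cons, mul_right_inj] at hdel
    have := lengthWrt_prod_le ((hlt.eraseIdx j).eraseIdx i)
    rw [← hdel, List.length_eraseIdx_of_lt (by omega), List.prod_append,
      List.prod_singleton] at this
    omega

theorem FoldingCondition.exchangeCondition (hsq : ∀ s ∈ S, s * s = 1) (hne : ∀ s ∈ S, s ≠ 1)
    (hgen : Subgroup.closure S = ⊤) (h : FoldingCondition S) : ExchangeCondition S := by
  intro l hl hred s hs
  induction l using List.reverseRecOn with
  | nil =>
    left
    simpa using lengthWrt_of_mem hsq hne hgen hs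
  | append_singleton l t ih =>
    have hl₀ : IsWord S l := fun x hx => hl x (List.mem_append_left _ hx)
    have ht : t ∈ S := hl t (by simp)
    have hred₀ := reduced_left_of_append hsq hgen hl₀ (by simpa [IsWord] using ht) hred
    rcases ih hl₀ hred₀ with h₁ | ⟨i, hi, hprod⟩
    · rw [List.prod_append, List.prod_singleton, List.length_append, List.length_singleton]
        at hred ⊢
      rcases h l.prod s hs t ht (by rw [h₁, hred₀]) (by rw [hred, hred₀]) with h₂ | h₂
      · left
        rw [← mul_assoc, h₂, hred₀]
      · right
        refine ⟨l.length, by simp, ?_⟩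
        rw [List.eraseIdx_append_of_length_le le_rfl]
        simpa using h₂.symm
    · right
      refine ⟨i, by simp; omega, ?_⟩
      rw [List.eraseIdx_append_of_lt_length hi, List.prod_append, List.prod_append, ← mul_assoc,
        ← hprod]

end Implications

section Presentation

/-- The alternating word `x, y, x, …` of length `n`. -/
def alternating {α : Type*} (x y : α) : ℕ → List α
  | 0 => []
  | n + 1 => x :: alternating y x n

theorem length_alternating {α : Type*} (x y : α) (n : ℕ) : (alternating x y n).length = n := by
  induction n generalizing x y with
  | zero => rfl
  | succ n ih => simp [alternating, ih]

theorem map_alternating {α β : Type*} (f : α → β) (x y : α) (n : ℕ) :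
    (alternating x y n).map f = alternating (f x) (f y) n := by
  induction n generalizing x y with
  | zero => rfl
  | succ n ih => simp [alternating, ih]

theorem exists_alternating_succ_eq_append {α : Type*} (x y : α) (n : ℕ) :
    ∃ z, alternating x y (n + 1) = alternating x y n ++ [z] := by
  induction n generalizing x y with
  | zero => exact ⟨x, rfl⟩
  | succ n ih =>
    obtain ⟨z, hz⟩ := ih y x
    exact ⟨z, by rw [alternating, hz]; rfl⟩

theorem prod_alternating {G : Type*} [Group G] {x y : G} (hx : x * x = 1) (hy : y * y = 1)
    (n : ℕ) : (alternating x y n).prod = (x * y) ^ n * (alternating y x n).prod := by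
  induction n with
  | zero => simp [alternating]
  | succ n ih =>
    have hy' : y⁻¹ = y := inv_eq_of_mul_eq_one_right hy
    have hconj : y * (x * y) ^ n = ((x * y) ^ n)⁻¹ * y := by
      have := conj_pow (i := n) (a := y) (b := x * y)
      rw [← mul_inv_eq_iff_eq_mul, ← this, ← inv_pow]
      congr 1
      rw [mul_inv_rev, hy', inv_eq_of_mul_eq_one_right hx, mul_assoc, mul_assoc, hy, mul_one]
    rw [alternating, alternating, List.prod_cons, List.prod_cons, ih, ← mul_assoc y, hconj,
      pow_succ', mul_assoc (x * y), mul_assoc (_⁻¹) y, mul_inv_cancel_left, mul_assoc x,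
      ← mul_assoc y, hy, one_mul]

variable {W : Type*} [Group W] {S : Set W}

/-- Under the exchange condition, a map to a group which respects the Coxeter relations takes the
same value on all reduced words of a given element. -/
theorem ExchangeCondition.map_prod_eq (h : ExchangeCondition S) (hsq : ∀ s ∈ S, s * s = 1)
    (hgen : Subgroup.closure S = ⊤) {G : Type*} [Group G] (f : W → G)
    (hf : ∀ s ∈ S, f s * f s = 1)
    (hfpow : ∀ s ∈ S, ∀ t ∈ S, (f s * f t) ^ orderOf (s * t) = 1) (n : ℕ) (a b : List W)
    (ha : IsWord S a) (hb : IsWord S b) (han : a.length = n) (hbn : b.length = n)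
    (hab : a.prod = b.prod) (hred : lengthWrt S a.prod = n) :
    (a.map f).prod = (b.map f).prod := by
  induction n generalizing a b with
  | zero => rw [List.length_eq_zero_iff.1 han, List.length_eq_zero_iff.1 hbn]
  | succ n ih =>
    obtain ⟨w, hw⟩ : ∃ w, a.prod = w := ⟨_, rfl⟩
    rw [hw] at hred
    let R (c : List W) : Prop := IsWord S c ∧ c.length = n + 1 ∧ c.prod = w
    have head {x : W} {u v : List W} (hu : R (x :: u)) (hv : R (x :: v)) :
        ((x :: u).map f).prod = ((x :: v).map f).prod := by
      obtain ⟨hu, hun, huw⟩ := hu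
      obtain ⟨hv, hvn, hvw⟩ := hv
      have hu' : IsWord S u := (List.forall_mem_cons.1 hu).2
      have hx : IsWord S [x] := by simpa [IsWord] using (List.forall_mem_cons.1 hu).1
      rw [List.map_cons, List.map_cons, List.prod_cons, List.prod_cons,
        ih u v hu' (List.forall_mem_cons.1 hv).2 (by simpa using hun) (by simpa using hvn)
          (by simpa using huw.trans hvw.symm)]
      rw [reduced_right_of_append hsq hgen hx hu' (by simp only [List.singleton_append, *])]
      simpa using hun
    have last {x : W} {u v : List W} (hu : R (u ++ [x])) (hv : R (v ++ [x])) :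
        ((u ++ [x]).map f).prod = ((v ++ [x]).map f).prod := by
      obtain ⟨hu, hun, huw⟩ := hu
      obtain ⟨hv, hvn, hvw⟩ := hv
      have hu' : IsWord S u := (List.forall_mem_append.1 hu).1
      rw [List.map_append, List.map_append, List.prod_append, List.prod_append,
        ih u v hu' (List.forall_mem_append.1 hv).1 (by simpa using hun) (by simpa using hvn)
          (by simpa using huw.trans hvw.symm)]
      rw [reduced_left_of_append hsq hgen hu' (List.forall_mem_append.1 hu).2
        (by simp only [*])]
      simpa using hun
    have step {a : List W} {z t : W} {v : List W} (ha : R (a ++ [z])) (hv : R (t :: v))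
        (hne : ((a ++ [z]).map f).prod ≠ ((t :: v).map f).prod) :
        R (t :: a) ∧ ((t :: a).map f).prod ≠ ((a ++ [z]).map f).prod := by
      have ht : t ∈ S := (List.forall_mem_cons.1 hv.1).1
      have han : a.length = n := by simpa using ha.2.1
      have hlt : lengthWrt S (t * w) ≤ n := by
        have := lengthWrt_prod_le (List.forall_mem_cons.1 hv.1).2
        rw [← hv.2.2, List.prod_cons, ← mul_assoc, hsq t ht, one_mul]
        have := hv.2.1
        simp only [List.length_cons] at this
        omega
      rcases h _ ha.1 (by rw [ha.2.2, hred, ha.2.1]) t ht with h₁ | ⟨i, hi, hprod⟩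
      · rw [ha.2.2, ha.2.1] at h₁
        omega
      · have hc : R (t :: (a ++ [z]).eraseIdx i) := by
          refine ⟨(ha.1.eraseIdx i).cons ht, ?_, ?_⟩
          · rw [List.length_cons, List.length_eraseIdx_of_lt hi, ha.2.1]
            rfl
          · rw [List.prod_cons, ← hprod, ha.2.2]
        have hcv := head hc hv
        rw [ha.2.1] at hi
        rcases (Nat.lt_succ_iff.1 hi).lt_or_eq with hi | rfl
        · rw [List.eraseIdx_append_of_lt_length (by omega), ← List.cons_append] at hc hcv
          exact absurd ((last ha hc).trans hcv) hne
        · rw [List.eraseIdx_append_of_length_le (by omega)] at hc hcv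
          simp only [han, Nat.sub_self, List.eraseIdx_zero, List.tail_cons, List.append_nil]
            at hc hcv
          exact ⟨hc, fun h' => hne (h'.symm.trans hcv)⟩
    by_contra hne
    have iter (k : ℕ) (hk : k ≤ n) : ∃ x y u v, R (alternating x y (k + 1) ++ u) ∧ R (y :: v) ∧
        ((alternating x y (k + 1) ++ u).map f).prod ≠ ((y :: v).map f).prod := by
      induction k with
      | zero =>
        obtain ⟨x, u, rfl⟩ := List.exists_cons_of_length_eq_add_one han
        obtain ⟨y, v, rfl⟩ := List.exists_cons_of_length_eq_add_one hbn
        exact ⟨x, y, u, v, ⟨ha, han, hw⟩, ⟨hb, hbn, hab ▸ hw⟩, hne⟩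
      | succ k ihk =>
        obtain ⟨x, y, u, v, hxu, hyv, hne⟩ := ihk (by omega)
        rcases List.eq_nil_or_concat' u with rfl | ⟨u, z, rfl⟩
        · have := hxu.2.1
          simp only [List.append_nil, length_alternating] at this
          omega
        · rw [← List.append_assoc] at hxu hne
          obtain ⟨h₁, h₂⟩ := step hxu hyv hne
          rw [List.append_assoc] at hxu h₂
          exact ⟨y, x, u, alternating y x k ++ (u ++ [z]), h₁, hxu, h₂⟩
    obtain ⟨x, y, u, v, hxu, hyv, hne⟩ := iter n le_rfl
    obtain rfl : u = [] := by
      have := hxu.2.1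
      rw [List.length_append, length_alternating] at this
      exact List.length_eq_zero_iff.1 (by omega)
    obtain ⟨z, hz⟩ := exists_alternating_succ_eq_append x y n
    rw [List.append_nil, hz] at hxu hne
    obtain ⟨h₁, h₂⟩ := step hxu hyv hne
    have hy : y ∈ S := (List.forall_mem_cons.1 hyv.1).1
    rw [← hz] at hxu h₂
    have hx : x ∈ S := (List.forall_mem_cons.1 hxu.1).1
    change R (alternating y x (n + 1)) at h₁
    change ((alternating y x (n + 1)).map f).prod ≠ _ at h₂
    have hpow : (y * x) ^ (n + 1) = 1 := by
      have := h₁.2.2.trans hxu.2.2.symm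
      rwa [prod_alternating (hsq y hy) (hsq x hx), mul_eq_right] at this
    apply h₂
    obtain ⟨k, hk⟩ := orderOf_dvd_of_pow_eq_one hpow
    rw [map_alternating, map_alternating, prod_alternating (hf y hy) (hf x hx), hk, pow_mul,
      hfpow y hy x hx, one_pow, one_mul]

theorem ExchangeCondition.exists_reduced_map_prod_eq (h : ExchangeCondition S)
    (hsq : ∀ s ∈ S, s * s = 1) (hgen : Subgroup.closure S = ⊤) {G : Type*} [Group G] (f : W → G)
    (hf : ∀ s ∈ S, f s * f s = 1)
    (hfpow : ∀ s ∈ S, ∀ t ∈ S, (f s * f t) ^ orderOf (s * t) = 1) (l : List W)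
    (hl : IsWord S l) : ∃ l', IsWord S l' ∧ lengthWrt S l'.prod = l'.length ∧
      l'.prod = l.prod ∧ (l'.map f).prod = (l.map f).prod := by
  induction l with
  | nil => exact ⟨[], hl, lengthWrt_one, rfl, rfl⟩
  | cons s l ih =>
    obtain ⟨hs, hl⟩ := List.forall_mem_cons.1 hl
    obtain ⟨a, ha, hared, haprod, hamap⟩ := ih hl
    rcases h a ha hared s hs with h₁ | ⟨i, hi, hprod⟩
    · exact ⟨s :: a, ha.cons hs, by simpa using h₁, by simp [haprod], by simp [hamap]⟩
    · have hlen : (s :: a.eraseIdx i).length = a.length := by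
        rw [List.length_cons, List.length_eraseIdx_of_lt hi]
        omega
      have hword : IsWord S [s] := by simpa [IsWord] using hs
      have hmap := h.map_prod_eq hsq hgen f hf hfpow a.length a (s :: a.eraseIdx i) ha
        ((ha.eraseIdx i).cons hs) rfl hlen (by rw [List.prod_cons, ← hprod]) hared
      refine ⟨a.eraseIdx i, ha.eraseIdx i, ?_, ?_, ?_⟩
      · apply reduced_right_of_append hsq hgen hword (ha.eraseIdx i)
        rw [List.singleton_append, hlen, List.prod_cons, ← hprod, hared]
      · rw [List.prod_cons, ← haprod, hprod, ← mul_assoc, hsq s hs, one_mul]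
      · rw [List.map_cons, List.prod_cons, ← hamap, hmap, List.map_cons, List.prod_cons,
          ← mul_assoc, hf s hs, one_mul]

theorem ExchangeCondition.isCoxeterSystemOn (hsq : ∀ s ∈ S, s * s = 1)
    (hgen : Subgroup.closure S = ⊤) (h : ExchangeCondition S) : IsCoxeterSystemOn S := by
  classical
  let M : CoxeterMatrix S :=
    { M := Matrix.of fun s t => orderOf ((s : W) * t)
      isSymm := by
        ext s t
        change orderOf ((t : W) * s) = orderOf ((s : W) * t)
        rw [← orderOf_inv, mul_inv_rev, inv_eq_of_mul_eq_one_right (hsq s s.2),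
          inv_eq_of_mul_eq_one_right (hsq t t.2)]
      diagonal := fun s => by
        change orderOf ((s : W) * s) = 1
        rw [hsq s s.2, orderOf_one]
      off_diagonal := fun s t hst h' => hst (by
        change orderOf ((s : W) * t) = 1 at h'
        rw [orderOf_eq_one_iff, mul_eq_one_iff_eq_inv,
          inv_eq_of_mul_eq_one_right (hsq t t.2)] at h'
        exact Subtype.ext h') }
  have hM (s t : S) : M s t = orderOf ((s : W) * t) := rfl
  let cs := M.toCoxeterSystem
  have hlift : M.IsLiftable fun s : S => (s : W) := fun s t => by
    rw [hM, pow_orderOf_eq_one]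
  let p : M.Group →* W := cs.lift ⟨_, hlift⟩
  have hp (s : S) : p (cs.simple s) = s := cs.lift_apply_simple hlift s
  let f : W → M.Group := fun w => if hw : w ∈ S then cs.simple ⟨w, hw⟩ else 1
  have hfs (s : S) : f s = cs.simple s := dif_pos s.2
  have hword (ω : List S) : cs.wordProd ω = ((ω.map (fun s : S => (s : W))).map f).prod := by
    rw [CoxeterSystem.wordProd, List.map_map, ← funext hfs]
    rfl
  have hbij : Function.Bijective p := by
    constructor
    · rw [injective_iff_map_eq_one]
      intro g hg
      obtain ⟨ω, rfl⟩ := cs.wordProd_surjective g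
      have hpω : p (cs.wordProd ω) = (ω.map (fun s : S => (s : W))).prod := by
        simp [CoxeterSystem.wordProd, map_list_prod, Function.comp_def, hp]
      obtain ⟨l, -, hlred, hlprod, hlmap⟩ := h.exists_reduced_map_prod_eq hsq hgen f
        (fun s hs => by rw [hfs ⟨s, hs⟩, cs.simple_mul_simple_self])
        (fun s hs t ht => by
          rw [hfs ⟨s, hs⟩, hfs ⟨t, ht⟩]
          exact cs.simple_mul_simple_pow ⟨s, hs⟩ ⟨t, ht⟩)
        (ω.map (fun s : S => (s : W))) (fun x hx => by
          obtain ⟨s, -, rfl⟩ := List.mem_map.1 hx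
          exact s.2)
      rw [hlprod, ← hpω, hg, lengthWrt_one] at hlred
      rw [hword, ← hlmap, List.length_eq_zero_iff.1 hlred.symm, List.map_nil, List.prod_nil]
    · rw [← MonoidHom.range_eq_top, eq_top_iff, ← hgen, Subgroup.closure_le]
      exact fun s hs => ⟨cs.simple ⟨s, hs⟩, hp ⟨s, hs⟩⟩
  exact ⟨M, cs.map (MulEquiv.ofBijective p hbij), hp⟩

end Presentation

/-- A group `W` generated by a set `S` of involutions is a Coxeter
system `(W, S)` if and only if it satisfies any one of the conditions (D), (E), (F). -/
theorem coxeter_iff_deletion_exchange_folding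
    {W : Type*} [Group W] (S : Set W)
    (hsq : ∀ s ∈ S, s * s = 1) (hne : ∀ s ∈ S, s ≠ 1)
    (hgen : Subgroup.closure S = ⊤) :
    (IsCoxeterSystemOn S ↔ DeletionCondition S) ∧
    (IsCoxeterSystemOn S ↔ ExchangeCondition S) ∧
    (IsCoxeterSystemOn S ↔ FoldingCondition S) := by
  have hCE := IsCoxeterSystemOn.exchangeCondition (S := S) hsq hgen
  have hED := ExchangeCondition.deletionCondition (S := S) hsq
  have hDF := DeletionCondition.foldingCondition (S := S) hsq hgen
  have hFE := FoldingCondition.exchangeCondition (S := S) hsq hne hgen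
  have hEC := ExchangeCondition.isCoxeterSystemOn (S := S) hsq hgen
  exact ⟨⟨hED ∘ hCE, hEC ∘ hFE ∘ hDF⟩, ⟨hCE, hEC⟩, ⟨hDF ∘ hED ∘ hCE, hEC ∘ hFE⟩⟩

end CoxeterPaper
end

section
/- Let (W,S) be a Coxeter system of finite rank. For any x ∈ W, the special subgroup W_{In(x)} generated by In(x) is a finite subgroup of W. -/
namespace CoxeterPaper

open List

section Exchange

variable {B W : Type*} [Group W] {M : CoxeterMatrix B} (cs : CoxeterSystem M W)

open Classical in
/-- The signed conjugation action of the simple reflection `s i` on `W × ZMod 2`: it conjugates the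
first component, and flips the sign exactly when the first component is `s i` itself. -/
noncomputable def signedConj (i : B) : Equiv.Perm (W × ZMod 2) :=
  Function.Involutive.toPerm
    (fun p => (cs.simple i * p.1 * cs.simple i, p.2 + if p.1 = cs.simple i then 1 else 0)) (by
      rintro ⟨t, e⟩
      have h : cs.simple i * t * cs.simple i = cs.simple i ↔ t = cs.simple i := by
        rw [mul_eq_right, ← cs.simple_mul_simple_self i, mul_right_inj]
      by_cases ht : t = cs.simple i
      · simp [ht, add_assoc, CharTwo.add_self_eq_zero]
      · simp only [h, ht, if_false, add_zero]
        simp [mul_assoc])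

open Classical in
theorem signedConj_apply (i : B) (t : W) (e : ZMod 2) :
    signedConj cs i (t, e) =
      (cs.simple i * t * cs.simple i, e + if t = cs.simple i then 1 else 0) := rfl

open Classical in
theorem prod_map_signedConj_apply (ω : List B) (t : W) (e : ZMod 2) :
    (ω.map (signedConj cs)).prod (t, e) =
      (cs.wordProd ω * t * (cs.wordProd ω)⁻¹, e + ((cs.rightInvSeq ω).count t : ZMod 2)) := by
  induction ω with
  | nil => simp
  | cons i ω ih =>
    have h : cs.wordProd ω * t * (cs.wordProd ω)⁻¹ = cs.simple i ↔
        (cs.wordProd ω)⁻¹ * cs.simple i * cs.wordProd ω = t := by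
      rw [mul_inv_eq_iff_eq_mul, mul_assoc, inv_mul_eq_iff_eq_mul, eq_comm]
    rw [map_cons, prod_cons, Equiv.Perm.mul_apply, ih, signedConj_apply]
    simp only [h, CoxeterSystem.rightInvSeq, count_cons, beq_iff_eq, cs.wordProd_cons, mul_inv_rev,
      cs.inv_simple, Nat.cast_add, Nat.cast_ite, Nat.cast_one, Nat.cast_zero, add_assoc]
    simp only [mul_assoc]

theorem alternatingWord_two_mul_succ (i j : B) (m : ℕ) :
    CoxeterSystem.alternatingWord i j (2 * (m + 1)) =
      i :: j :: CoxeterSystem.alternatingWord i j (2 * m) := by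
  rw [show 2 * (m + 1) = 2 * m + 1 + 1 by ring, CoxeterSystem.alternatingWord_succ',
    CoxeterSystem.alternatingWord_succ']
  simp

theorem reverse_alternatingWord_two_mul (i j : B) (m : ℕ) :
    (CoxeterSystem.alternatingWord i j (2 * m)).reverse =
      CoxeterSystem.alternatingWord j i (2 * m) := by
  induction m with
  | zero => rfl
  | succ m ih =>
    rw [alternatingWord_two_mul_succ, reverse_cons, reverse_cons, ih,
      show 2 * (m + 1) = 2 * m + 1 + 1 by ring, CoxeterSystem.alternatingWord_succ,
      CoxeterSystem.alternatingWord_succ]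
    simp

theorem prod_map_alternatingWord {G : Type*} [Monoid G] (f : B → G) (i j : B) (m : ℕ) :
    ((CoxeterSystem.alternatingWord i j (2 * m)).map f).prod = (f i * f j) ^ m := by
  induction m with
  | zero => simp [CoxeterSystem.alternatingWord]
  | succ m ih =>
    rw [alternatingWord_two_mul_succ, map_cons, map_cons, prod_cons, prod_cons, ih, pow_succ',
      mul_assoc]

theorem wordProd_alternatingWord_two_mul_matrix (i j : B) :
    cs.wordProd (CoxeterSystem.alternatingWord i j (2 * M i j)) = 1 := by
  rw [CoxeterSystem.wordProd, prod_map_alternatingWord, cs.simple_mul_simple_pow]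

open Classical in
theorem even_count_rightInvSeq_alternatingWord (i j : B) (t : W) :
    Even ((cs.rightInvSeq (CoxeterSystem.alternatingWord i j (2 * M i j))).count t) := by
  rw [← reverse_alternatingWord_two_mul j i, cs.rightInvSeq_reverse, count_reverse]
  set L := cs.leftInvSeq (CoxeterSystem.alternatingWord j i (2 * M i j)) with hL
  have hlen : L.length = 2 * M i j := by simp [hL]
  have h : L.take (M i j) = L.drop (M i j) := by
    apply List.ext_getElem
    · simp [hlen]; omega
    · intro k hk hk'
      simp only [length_take, length_drop, hlen] at hk hk'
      rw [getElem_take, getElem_drop]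
      simp only [hL]
      rw [cs.getElem_leftInvSeq_alternatingWord j i _ _ (by omega),
        cs.getElem_leftInvSeq_alternatingWord j i _ _ (by omega),
        cs.prod_alternatingWord_eq_mul_pow, cs.prod_alternatingWord_eq_mul_pow]
      have e1 : ¬ Even (2 * k + 1) := by simp
      have e2 : ¬ Even (2 * (M i j + k) + 1) := by simp
      rw [if_neg e1, if_neg e2, show (2 * k + 1) / 2 = k by omega,
        show (2 * (M i j + k) + 1) / 2 = M i j + k by omega, pow_add]
      simp
  rw [← take_append_drop (M i j) L, count_append, h]
  exact ⟨_, rfl⟩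

theorem isLiftable_signedConj : M.IsLiftable (signedConj cs) := by
  classical
  intro i j
  rw [← prod_map_alternatingWord]
  ext1 ⟨t, e⟩
  rw [prod_map_signedConj_apply, wordProd_alternatingWord_two_mul_matrix,
    (ZMod.natCast_eq_zero_iff_even).2 (even_count_rightInvSeq_alternatingWord cs i j t)]
  simp

open Classical in
/-- The parity of the number of occurrences of `t` in the right inversion sequence of a word
depends only on the element the word represents. -/
theorem count_rightInvSeq_congr {ω ω' : List B} (h : cs.wordProd ω = cs.wordProd ω') (t : W) :
    ((cs.rightInvSeq ω).count t : ZMod 2) = (cs.rightInvSeq ω').count t := by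
  have key (ω : List B) : cs.lift ⟨signedConj cs, isLiftable_signedConj cs⟩ (cs.wordProd ω) =
      (ω.map (signedConj cs)).prod := by
    rw [CoxeterSystem.wordProd, map_list_prod, map_map]
    congr 2
    ext1 i
    exact cs.lift_apply_simple (isLiftable_signedConj cs) i
  have heval := congrArg (fun f : Equiv.Perm (W × ZMod 2) => (f (t, 0)).2)
    ((key ω).symm.trans ((congrArg _ h).trans (key ω')))
  simpa [prod_map_signedConj_apply] using heval

/-- The exchange property. -/
theorem exists_wordProd_eraseIdx_of_isRightDescent {ω : List B} {i : B}
    (hi : cs.IsRightDescent (cs.wordProd ω) i) :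
    ∃ k < ω.length, cs.wordProd ω * cs.simple i = cs.wordProd (ω.eraseIdx k) := by
  classical
  have hmem : cs.simple i ∈ cs.rightInvSeq ω := by
    obtain ⟨ν, hν, hprod⟩ := cs.exists_isReduced (cs.wordProd ω * cs.simple i)
    have hnot : cs.simple i ∉ cs.rightInvSeq ν := fun hmem => by
      have := (cs.isRightInversion_of_mem_rightInvSeq hν hmem).2
      rw [← hprod, cs.simple_mul_simple_cancel_right] at this
      exact lt_asymm hi this
    have hw : cs.wordProd ω = cs.wordProd (ν.concat i) := by
      rw [cs.wordProd_concat, ← hprod, cs.simple_mul_simple_cancel_right]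
    have hcount := count_rightInvSeq_congr cs hw (cs.simple i)
    have hzero : count (cs.simple i) ((cs.rightInvSeq ν).map (MulAut.conj (cs.simple i))) = 0 := by
      rw [count_eq_zero, mem_map]
      rintro ⟨t, ht, hts⟩
      have : t = cs.simple i := by
        rw [MulAut.conj_apply, mul_inv_eq_iff_eq_mul, mul_right_inj] at hts
        exact hts
      exact hnot (this ▸ ht)
    rw [cs.rightInvSeq_concat, concat_eq_append, count_append, hzero] at hcount
    by_contra hcon
    rw [count_eq_zero.2 hcon] at hcount
    simp at hcount
  obtain ⟨k, hk, hks⟩ := mem_iff_getElem.1 hmem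
  refine ⟨k, by simpa using hk, ?_⟩
  rw [← cs.wordProd_mul_getD_rightInvSeq, getD_eq_getElem _ _ hk, hks]

theorem exists_isReduced_of_mem_closure {I : Set B} {v : W}
    (hv : v ∈ Subgroup.closure (cs.simple '' I)) :
    ∃ ω : List B, (∀ i ∈ ω, i ∈ I) ∧ cs.IsReduced ω ∧ v = cs.wordProd ω := by
  have step (u : W) (i : B) (hi : i ∈ I)
      (hu : ∃ ω : List B, (∀ i ∈ ω, i ∈ I) ∧ cs.IsReduced ω ∧ u = cs.wordProd ω) :
      ∃ ω : List B, (∀ i ∈ ω, i ∈ I) ∧ cs.IsReduced ω ∧ u * cs.simple i = cs.wordProd ω := by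
    obtain ⟨ω, hI, hω, rfl⟩ := hu
    by_cases hd : cs.IsRightDescent (cs.wordProd ω) i
    · obtain ⟨k, hk, hprod⟩ := exists_wordProd_eraseIdx_of_isRightDescent cs hd
      refine ⟨ω.eraseIdx k, fun j hj => hI j (mem_of_mem_eraseIdx hj), ?_, hprod⟩
      have h1 := cs.isRightDescent_iff.1 hd
      have h2 := length_eraseIdx_add_one hk
      have h3 := hω.eq
      rw [CoxeterSystem.IsReduced, ← hprod]
      omega
    · refine ⟨ω ++ [i], ?_, ?_, by rw [cs.wordProd_append, cs.wordProd_singleton]⟩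
      · simpa [or_imp, forall_and] using ⟨hI, hi⟩
      · rw [CoxeterSystem.IsReduced, cs.wordProd_append, cs.wordProd_singleton,
          cs.not_isRightDescent_iff.1 hd, hω.eq, length_append, length_singleton]
  induction hv using Subgroup.closure_induction_right with
  | one => exact ⟨[], by simp, by simp [CoxeterSystem.IsReduced], by simp⟩
  | mul_right u y _ hy ih =>
    obtain ⟨i, hi, rfl⟩ := hy
    exact step u i hi ih
  | mul_inv_cancel u y _ hy ih =>
    obtain ⟨i, hi, rfl⟩ := hy
    rw [cs.inv_simple]
    exact step u i hi ih

/-- Every reduced word in the right descents of `x` is a suffix of a reduced word for `x`. -/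
theorem exists_append_isReduced_of_forall_isRightDescent {x : W} {ω : List B}
    (hI : ∀ i ∈ ω, cs.IsRightDescent x i) (hω : cs.IsReduced ω) :
    ∃ ν : List B, cs.IsReduced (ν ++ ω) ∧ x = cs.wordProd (ν ++ ω) := by
  induction ω using List.reverseRecOn with
  | nil => simpa using cs.exists_isReduced x
  | append_singleton ω i ih =>
    have hω' : cs.IsReduced ω := by simpa using hω.take ω.length
    obtain ⟨ν, hν, rfl⟩ := ih (fun j hj => hI j (by simp [hj])) hω'
    have hd := hI i (by simp)
    obtain ⟨k, hk, hprod⟩ := exists_wordProd_eraseIdx_of_isRightDescent cs hd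
    have hkν : k < ν.length := by
      by_contra! hle
      rw [eraseIdx_append_of_length_le hle, cs.wordProd_append, cs.wordProd_append, mul_assoc,
        mul_right_inj] at hprod
      have h1 := hω.eq
      rw [cs.wordProd_append, cs.wordProd_singleton, hprod, length_append, length_singleton] at h1
      have h2 := cs.length_wordProd_le (ω.eraseIdx (k - ν.length))
      have h3 := length_eraseIdx_le ω (k - ν.length)
      omega
    rw [eraseIdx_append_of_lt_length hkν] at hprod
    have hx : cs.wordProd (ν ++ ω) = cs.wordProd (ν.eraseIdx k ++ (ω ++ [i])) := by
      rw [← append_assoc, cs.wordProd_append _ [i], cs.wordProd_singleton, ← hprod,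
        cs.simple_mul_simple_cancel_right]
    refine ⟨ν.eraseIdx k, ?_, hx⟩
    rw [CoxeterSystem.IsReduced, ← hx, hν.eq]
    have := length_eraseIdx_add_one hkν
    simp only [length_append, length_singleton]
    omega

theorem finite_setOf_length_le [Finite B] (n : ℕ) : {w : W | cs.length w ≤ n}.Finite := by
  refine ((List.finite_length_le B n).image cs.wordProd).subset fun w hw => ?_
  obtain ⟨ω, hω, rfl⟩ := cs.exists_isReduced w
  exact ⟨ω, hω.eq.symm.trans_le hw, rfl⟩

end Exchange

/-- For any `x ∈ W`, the special subgroup generated by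
`In(x) = {s ∈ S : l(xs) = l(x) - 1}` is finite. -/
theorem special_subgroup_of_descent_set_finite
    {B W : Type*} [Fintype B] [Group W] {M : CoxeterMatrix B} (cs : CoxeterSystem M W)
    (x : W) :
    Finite (Subgroup.closure
      (cs.simple '' {i : B | cs.length (x * cs.simple i) + 1 = cs.length x}) :
      Subgroup W) := by
  refine ((finite_setOf_length_le cs (cs.length x)).subset fun v hv => ?_).to_subtype
  obtain ⟨ω, hI, hω, rfl⟩ := exists_isReduced_of_mem_closure cs hv
  obtain ⟨ν, hν, hx⟩ := exists_append_isReduced_of_forall_isRightDescent cs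
    (fun i hi => cs.isRightDescent_iff.2 (hI i hi)) hω
  have h1 := hν.eq
  have h2 := hω.eq
  rw [← hx, length_append] at h1
  change cs.length (cs.wordProd ω) ≤ cs.length x
  omega

end CoxeterPaper
end
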